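/- arXiv:1505.01957 — 4 statements merged into one kernel-verified Lean document; each statement's English description precedes it below -/
import Mathlib

section
/- Let m ≥ 2 and let Σ = (σ_ij) be an m×m positive semi-definite real matrix with σ_jj > 0 for all 1 ≤ j ≤ m. Let X = (X_1,…,X_m) and Y = (Y_1,…,Y_m) be independent random vectors, each distributed as the multivariate normal N(0, Σ). Let w_1,…,w_m be nonnegative real constants with w_1 + ⋯ + w_m = 1. Then the random variable Z = Σ_{j=1}^m w_j (X_j / Y_j) has the standard Cauchy distribution Cauchy(0,1). -/
open MeasureTheory ProbabilityTheory Real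

/-- The standard Cauchy distribution `Cauchy(0,1)`, with density `π⁻¹ (1 + z²)⁻¹` on `ℝ`. -/
noncomputable def stdCauchy : Measure ℝ :=
  volume.withDensity fun z => ENNReal.ofReal (π⁻¹ * (1 + z ^ 2)⁻¹)

/-- A measure `μ` on `ℝᵐ` is the centered multivariate normal distribution `N(0, S)`
iff it is a probability measure and every linear functional `x ↦ ∑ i, t i * x i`
pushes it forward to a centered real Gaussian with variance `t Σ tᵀ` (Cramér–Wold). -/
def IsMvGaussian {m : ℕ} (S : Matrix (Fin m) (Fin m) ℝ) (μ : Measure (Fin m → ℝ)) : Prop :=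
  IsProbabilityMeasure μ ∧
    ∀ t : Fin m → ℝ,
      μ.map (fun x => ∑ i, t i * x i) =
        gaussianReal 0 (Real.toNNReal (∑ i, ∑ j, t i * S i j * t j))

/-- The disc function `exp (t ∑ w_j (c_j ζ - 1)/(c_j ζ + 1))`. -/
noncomputable def discFun {m : ℕ} (w : Fin m → ℝ) (c : Fin m → ℂ) (t : ℝ) (z : ℂ) : ℂ :=
  Complex.exp (t * ∑ j, (w j : ℂ) * ((c j * z - 1) / (c j * z + 1)))

lemma cayley_re_nonpos (z : ℂ) (hz : ‖z‖ ≤ 1) : ((z - 1) / (z + 1)).re ≤ 0 := by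
  rw [Complex.div_re, ← add_div]
  apply div_nonpos_of_nonpos_of_nonneg _ (Complex.normSq_nonneg _)
  have h : ‖z‖ ^ 2 ≤ 1 := by nlinarith [norm_nonneg z]
  rw [← Complex.normSq_eq_norm_sq, Complex.normSq_apply] at h
  simp
  nlinarith

lemma discFun_norm_le {m : ℕ} (w : Fin m → ℝ) (hw0 : ∀ j, 0 ≤ w j) (c : Fin m → ℂ)
    (hc : ∀ j, ‖c j‖ = 1) (t : ℝ) (ht : 0 ≤ t) (z : ℂ) (hz : ‖z‖ ≤ 1) :
    ‖discFun w c t z‖ ≤ 1 := by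
  rw [discFun, Complex.norm_exp, Real.exp_le_one_iff, Complex.re_ofReal_mul, Complex.re_sum]
  apply mul_nonpos_of_nonneg_of_nonpos ht
  apply Finset.sum_nonpos
  intro j _
  rw [Complex.re_ofReal_mul]
  exact mul_nonpos_of_nonneg_of_nonpos (hw0 j) (cayley_re_nonpos _ (by simpa [hc j] using hz))

lemma discFun_diffAt {m : ℕ} (w : Fin m → ℝ) (c : Fin m → ℂ) (t : ℝ) (z : ℂ)
    (hz : ∀ j, c j * z + 1 ≠ 0) : DifferentiableAt ℂ (discFun w c t) z := by
  unfold discFun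
  have : ∀ j, DifferentiableAt ℂ (fun z : ℂ => (c j * z - 1) / (c j * z + 1)) z := fun j =>
    DifferentiableAt.div (by fun_prop) (by fun_prop) (hz j)
  fun_prop

lemma discFun_measurable {m : ℕ} (w : Fin m → ℝ) (c : Fin m → ℂ) (t : ℝ) :
    Measurable (discFun w c t) := by
  unfold discFun
  fun_prop

lemma discFun_average {m : ℕ} (w : Fin m → ℝ) (hw0 : ∀ j, 0 ≤ w j) (hw1 : ∑ j, w j = 1)
    (c : Fin m → ℂ) (hc : ∀ j, ‖c j‖ = 1) (t : ℝ) (ht : 0 ≤ t) :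
    ∫ θ in 0..2 * π, discFun w c t (circleMap 0 1 θ) = (2 * π) * Complex.exp (-t) := by
  set r : ℕ → ℝ := fun n => 1 - 1 / ((n : ℝ) + 1) with hr
  have hr0 : ∀ n, 0 ≤ r n := fun n => by
    have : 1 / ((n : ℝ) + 1) ≤ 1 := by
      rw [div_le_one (by positivity)]; linarith [n.cast_nonneg (α := ℝ)]
    simp only [hr]; linarith
  have hr1 : ∀ n, r n < 1 := fun n => by
    have : 0 < 1 / ((n : ℝ) + 1) := by positivity
    simp only [hr]; linarith
  have hrt : Filter.Tendsto r Filter.atTop (nhds 1) := by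
    simpa [hr] using (tendsto_const_nhds (x := (1 : ℝ))).sub tendsto_one_div_add_atTop_nhds_zero_nat
  have hval : ∀ n, ∫ θ in 0..2 * π, discFun w c t (circleMap 0 (r n) θ)
      = (2 * π) * Complex.exp (-t) := by
    intro n
    have hd : DiffContOnCl ℂ (discFun w c t) (Metric.ball 0 |r n|) := by
      apply DifferentiableOn.diffContOnCl
      intro z hz
      apply DifferentiableAt.differentiableWithinAt
      apply discFun_diffAt
      intro j h0
      have hz' : ‖z‖ ≤ |r n| := by
        simpa using Metric.closure_ball_subset_closedBall hz
      rw [abs_of_nonneg (hr0 n)] at hz'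
      have : c j * z = -1 := eq_neg_of_add_eq_zero_left h0
      have := congrArg norm this
      simp [hc j] at this
      linarith [hr1 n]
    have h := hd.circleAverage
    rw [circleAverage_def] at h
    have h0 : discFun w c t 0 = Complex.exp (-t) := by
      have : ∑ j, (w j : ℂ) = 1 := by exact_mod_cast hw1
      simp [discFun, this]
    rw [h0, inv_smul_eq_iff₀ (by positivity)] at h
    rw [h]
    simp
  refine tendsto_nhds_unique (l := Filter.atTop) ?_ ((Filter.tendsto_congr hval).2 tendsto_const_nhds)
  apply intervalIntegral.tendsto_integral_filter_of_dominated_convergence (fun _ => 1)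
  · refine Filter.Eventually.of_forall fun n => Measurable.aestronglyMeasurable ?_
    exact (discFun_measurable w c t).comp (by fun_prop)
  · refine Filter.Eventually.of_forall fun n => Filter.Eventually.of_forall fun θ _ => ?_
    apply discFun_norm_le w hw0 c hc t ht
    simpa [abs_of_nonneg (hr0 n)] using (hr1 n).le
  · exact intervalIntegrable_const
  · have hcount : ∀ j, ∀ᵐ θ : ℝ, circleMap 0 1 θ ≠ -(c j)⁻¹ := fun j => by
      rw [ae_iff]
      have := ((Set.countable_singleton (-(c j)⁻¹)).preimage_circleMap 0
        (one_ne_zero (α := ℝ))).measure_zero volume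
      simpa using! this
    filter_upwards [ae_all_iff.2 hcount] with θ hθ _
    have hcd : ContinuousAt (discFun w c t) (circleMap 0 1 θ) := by
      apply (discFun_diffAt w c t _ _).continuousAt
      intro j h0
      apply hθ j
      have hcj : c j ≠ 0 := by
        intro h; have := hc j; simp [h] at this
      have : c j * circleMap 0 1 θ = -1 := eq_neg_of_add_eq_zero_left h0
      field_simp
      linear_combination this
    refine hcd.tendsto.comp ?_
    have : Continuous fun s : ℝ => circleMap 0 s θ := by unfold circleMap; fun_prop
    exact (this.tendsto 1).comp hrt

lemma ratio_eq (x y α : ℝ) (hy : y ≠ 0) :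
    (((y + x * Complex.I) / (y - x * Complex.I) : ℂ) * circleMap 0 1 (2 * α) - 1) /
      (((y + x * Complex.I) / (y - x * Complex.I) : ℂ) * circleMap 0 1 (2 * α) + 1)
    = (((cos α * x + sin α * y) / (-sin α * x + cos α * y) : ℝ) : ℂ) * Complex.I := by
  have hb0 : (y - x * Complex.I : ℂ) ≠ 0 := by
    intro h
    have := congrArg Complex.re h
    simp at this
    exact hy this
  have hcs : (cos α : ℂ) ^ 2 + (sin α : ℂ) ^ 2 = 1 := by
    exact_mod_cast cos_sq_add_sin_sq α
  have he0 : (cos α - sin α * Complex.I : ℂ) ≠ 0 := by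
    intro h
    have h2 : ((cos α - sin α * Complex.I : ℂ)) * (cos α + sin α * Complex.I) = 1 := by
      linear_combination hcs - (sin α : ℂ) ^ 2 * Complex.I_sq
    rw [h] at h2; simp at h2
  have hz : circleMap 0 1 (2 * α) = (cos α + sin α * Complex.I) / (cos α - sin α * Complex.I) := by
    rw [eq_div_iff he0, circleMap]
    have : ((2 * α : ℝ) : ℂ) * Complex.I = α * Complex.I + α * Complex.I := by push_cast; ring
    rw [this, Complex.exp_add, Complex.exp_mul_I]
    push_cast at *
    linear_combination (Complex.cos α + Complex.sin α * Complex.I) * (hcs - (Complex.sin α : ℂ) ^ 2 * Complex.I_sq)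
  set a : ℂ := (y + x * Complex.I) * (cos α + sin α * Complex.I) with ha
  set b : ℂ := (y - x * Complex.I) * (cos α - sin α * Complex.I) with hb
  have hbne : b ≠ 0 := mul_ne_zero hb0 he0
  rw [hz, div_mul_div_comm, ← ha, ← hb, div_sub_one hbne, div_add_one hbne,
    div_div_div_cancel_right₀ hbne]
  have h1 : a - b = 2 * ((cos α * x + sin α * y) * Complex.I) := by rw [ha, hb]; ring
  have h2 : a + b = 2 * (-sin α * x + cos α * y) := by
    rw [ha, hb]; linear_combination 2 * x * sin α * Complex.I_sq
  rw [h1, h2, mul_div_mul_left _ _ two_ne_zero]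
  push_cast
  ring

lemma angle_average {m : ℕ} (w : Fin m → ℝ) (hw0 : ∀ j, 0 ≤ w j) (hw1 : ∑ j, w j = 1)
    (x y : Fin m → ℝ) (hy : ∀ j, y j ≠ 0) (t : ℝ) (ht : 0 ≤ t) :
    ∫ α in (-(π / 2))..(π / 2), Complex.exp (t * (∑ j, w j * ((cos α * x j + sin α * y j) /
      (-sin α * x j + cos α * y j)) : ℝ) * Complex.I) = π * Complex.exp (-t) := by
  set c : Fin m → ℂ := fun j => (y j + x j * Complex.I) / (y j - x j * Complex.I) with hcdef
  have hc : ∀ j, ‖c j‖ = 1 := by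
    intro j
    have hb0 : (y j - x j * Complex.I : ℂ) ≠ 0 := by
      intro h
      have := congrArg Complex.re h
      simp at this
      exact hy j this
    have : (y j + x j * Complex.I : ℂ) = (starRingEnd ℂ) (y j - x j * Complex.I) := by simp
    rw [hcdef]
    simp only
    rw [norm_div, this, RCLike.norm_conj, div_self (norm_ne_zero_iff.2 hb0)]
  have h1 : ∀ α : ℝ, Complex.exp (t * (∑ j, w j * ((cos α * x j + sin α * y j) /
      (-sin α * x j + cos α * y j)) : ℝ) * Complex.I)
      = (fun θ : ℝ => discFun w c t (circleMap 0 1 θ)) (2 * α) := by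
    intro α
    simp only [discFun, hcdef]
    simp_rw [ratio_eq _ _ α (hy _)]
    congr 1
    rw [Complex.ofReal_sum, mul_assoc, Finset.sum_mul]
    simp_rw [Complex.ofReal_mul, mul_assoc]
  simp_rw [h1]
  rw [intervalIntegral.integral_comp_mul_left (fun θ : ℝ => discFun w c t (circleMap 0 1 θ))
    (two_ne_zero)]
  have hper : Function.Periodic (fun θ : ℝ => discFun w c t (circleMap 0 1 θ)) (2 * π) := by
    intro θ
    simp only [periodic_circleMap 0 1 θ]
  have h2 := hper.intervalIntegral_add_eq (2 * -(π / 2)) 0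
  rw [show 2 * -(π / 2) + 2 * π = 2 * (π / 2) by ring, zero_add] at h2
  rw [h2, discFun_average w hw0 hw1 c hc t ht]
  simp
  ring

lemma stdCauchy_eq : stdCauchy = cauchyMeasure 0 1 := by
  rw [cauchyMeasure_of_scale_ne_zero _ one_ne_zero, stdCauchy]
  congr 1
  ext z
  simp [cauchyPDF, cauchyPDFReal, add_comm]

instance : IsProbabilityMeasure stdCauchy := by
  rw [stdCauchy_eq]; infer_instance

lemma charFun_stdCauchy (t : ℝ) (ht : 0 ≤ t) : charFun stdCauchy t = Complex.exp (-t) := by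
  rw [charFun_apply_real, stdCauchy, integral_withDensity_eq_integral_toReal_smul (by fun_prop)
    (by simp)]
  have hpos : ∀ z : ℝ, 0 ≤ π⁻¹ * (1 + z ^ 2)⁻¹ := fun z => by positivity
  simp_rw [ENNReal.toReal_ofReal (hpos _)]
  have h := integral_image_eq_integral_abs_deriv_smul (s := Set.Ioo (-(π / 2)) (π / 2))
    (f := tan) (f' := fun x => 1 / cos x ^ 2) measurableSet_Ioo
    (fun x hx => (hasDerivAt_tan_of_mem_Ioo hx).hasDerivWithinAt) injOn_tan
    (fun z : ℝ => (π⁻¹ * (1 + z ^ 2)⁻¹) • Complex.exp (t * z * Complex.I))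
  rw [image_tan_Ioo, setIntegral_univ] at h
  rw [h]
  have hA := angle_average (m := 1) (fun _ => 1) (by simp) (by simp) (fun _ => 0) (fun _ => 1)
    (by simp) t ht
  rw [intervalIntegral.integral_of_le (by linarith [pi_pos]), integral_Ioc_eq_integral_Ioo] at hA
  have : Complex.exp (-t) = (π⁻¹ : ℝ) • (π * Complex.exp (-t)) := by
    have : (π : ℂ) ≠ 0 := by exact_mod_cast pi_ne_zero
    rw [Complex.real_smul]
    push_cast
    field_simp
  rw [this, ← hA, ← integral_smul]
  apply setIntegral_congr_fun measurableSet_Ioo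
  intro x hx
  have hcos := cos_pos_of_mem_Ioo hx
  have h3 : |1 / cos x ^ 2| * (π⁻¹ * (1 + tan x ^ 2)⁻¹) = π⁻¹ := by
    rw [inv_one_add_tan_sq hcos.ne', abs_of_pos (by positivity)]
    field_simp
  simp only [smul_smul, h3]
  simp [tan_eq_sin_div_cos]

lemma map_dual {m : ℕ} {S : Matrix (Fin m) (Fin m) ℝ} {μ : Measure (Fin m → ℝ)}
    (h : IsMvGaussian S μ) (L : StrongDual ℝ (Fin m → ℝ)) :
    μ.map L = gaussianReal 0 (Real.toNNReal
      (∑ i, ∑ j, L (Pi.single i 1) * S i j * L (Pi.single j 1))) := by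
  rw [← h.2 (fun i => L (Pi.single i 1))]
  congr 1
  ext x
  conv_lhs => rw [← Finset.univ_sum_single x]
  rw [map_sum]
  refine Finset.sum_congr rfl fun i _ => ?_
  rw [mul_comm, ← smul_eq_mul, ← map_smul, ← Pi.single_smul]
  simp

lemma integral_dual {m : ℕ} {S : Matrix (Fin m) (Fin m) ℝ} {μ : Measure (Fin m → ℝ)}
    (h : IsMvGaussian S μ) (L : StrongDual ℝ (Fin m → ℝ)) : μ[L] = 0 := by
  have h1 := map_dual h L
  have : ∫ x, x ∂(μ.map L) = μ[L] := integral_map (by fun_prop) (by fun_prop)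
  rw [← this, h1, integral_id_gaussianReal]

lemma isGaussian_of {m : ℕ} {S : Matrix (Fin m) (Fin m) ℝ} {μ : Measure (Fin m → ℝ)}
    (h : IsMvGaussian S μ) : IsGaussian μ where
  map_eq_gaussianReal L := by
    rw [integral_dual h L]
    have h1 := map_dual h L
    have : Var[id; μ.map L] = Var[L; μ] := by
      rw [variance_map (by fun_prop) (by fun_prop)]; rfl
    rw [← this, h1, variance_id_gaussianReal, Real.toNNReal_coe]

lemma mv_unique {m : ℕ} {S : Matrix (Fin m) (Fin m) ℝ} {μ ν : Measure (Fin m → ℝ)}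
    (h : IsMvGaussian S μ) (h' : IsMvGaussian S ν) : μ = ν := by
  have := h.1
  have := h'.1
  apply Measure.ext_of_charFunDual
  ext L
  rw [charFunDual_eq_charFun_map_one, charFunDual_eq_charFun_map_one, map_dual h, map_dual h']

lemma mv_ne_zero {m : ℕ} {S : Matrix (Fin m) (Fin m) ℝ} {μ : Measure (Fin m → ℝ)}
    (h : IsMvGaussian S μ) (j : Fin m) (hj : 0 < S j j) : ∀ᵐ x ∂μ, x j ≠ 0 := by
  have h1 := map_dual h (ContinuousLinearMap.proj j)
  have h2 : (∑ i, ∑ k, (ContinuousLinearMap.proj (R := ℝ) (φ := fun _ : Fin m => ℝ) j)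
      (Pi.single i 1) * S i k * (ContinuousLinearMap.proj (R := ℝ) (φ := fun _ : Fin m => ℝ) j)
      (Pi.single k 1)) = S j j := by
    simp [Pi.single_apply]
  rw [h2] at h1
  have : NullSingletonClass (gaussianReal 0 (S j j).toNNReal) := nullSingletonClass_gaussianReal (by simpa using hj)
  have h3 : ∀ᵐ z ∂(μ.map (ContinuousLinearMap.proj (R := ℝ) (φ := fun _ : Fin m => ℝ) j)),
      z ≠ 0 := by
    rw [h1, ae_iff]; simpa using! measure_singleton (μ := gaussianReal 0 (S j j).toNNReal) 0
  exact ae_of_ae_map (p := fun z : ℝ => z ≠ 0) (ContinuousLinearMap.measurable _).aemeasurable h3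

lemma charFun_main {m : ℕ} (S : Matrix (Fin m) (Fin m) ℝ) (hdiag : ∀ j, 0 < S j j)
    (μ : Measure (Fin m → ℝ)) (hμ : IsMvGaussian S μ)
    (w : Fin m → ℝ) (hw0 : ∀ j, 0 ≤ w j) (hw1 : ∑ j, w j = 1) (t : ℝ) (ht : 0 ≤ t) :
    charFun ((μ.prod μ).map (fun p => ∑ j, w j * (p.1 j / p.2 j))) t = Complex.exp (-t) := by
  have := hμ.1
  have := isGaussian_of hμ
  set g : (Fin m → ℝ) × (Fin m → ℝ) → ℂ := fun p =>
    Complex.exp (t * (∑ j, w j * (p.1 j / p.2 j) : ℝ) * Complex.I) with hg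
  have hgm : Measurable g := by rw [hg]; fun_prop
  rw [charFun_apply_real, integral_map (by fun_prop) (by fun_prop)]
  change ∫ p, g p ∂(μ.prod μ) = _
  have hrot : ∀ α : ℝ, ∫ p, g (ContinuousLinearMap.rotation α p) ∂(μ.prod μ)
      = ∫ p, g p ∂(μ.prod μ) := by
    intro α
    have h := IsGaussian.map_rotation_eq_self_of_forall_strongDual_eq_zero
      (fun L => integral_dual hμ L) α
    conv_rhs => rw [← h]
    rw [integral_map (by fun_prop) hgm.aestronglyMeasurable]
  have hI : ∫ α in (-(π / 2))..(π / 2), ∫ p, g (ContinuousLinearMap.rotation α p) ∂(μ.prod μ)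
      = π * ∫ p, g p ∂(μ.prod μ) := by
    simp_rw [hrot]
    simp
  have hJ : ∫ α in (-(π / 2))..(π / 2), ∫ p, g (ContinuousLinearMap.rotation α p) ∂(μ.prod μ)
      = ∫ p, (∫ α in (-(π / 2))..(π / 2), g (ContinuousLinearMap.rotation α p)) ∂(μ.prod μ) := by
    simp_rw [intervalIntegral.integral_of_le (show -(π / 2) ≤ π / 2 by linarith [pi_pos])]
    apply integral_integral_swap
    apply Integrable.of_bound (C := 1)
    · apply Measurable.aestronglyMeasurable
      apply hgm.comp
      simp only [ContinuousLinearMap.rotation_apply]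
      fun_prop
    · refine Filter.Eventually.of_forall fun q => ?_
      simp only [Function.uncurry, hg]
      rw [← Complex.ofReal_mul, Complex.norm_exp_ofReal_mul_I]
  have hne : ∀ᵐ p ∂(μ.prod μ), ∀ j, p.2 j ≠ 0 := by
    rw [ae_all_iff]
    intro j
    exact (Measure.quasiMeasurePreserving_snd (μ := μ) (ν := μ)).ae (mv_ne_zero hμ j (hdiag j))
  have hK : ∫ p, (∫ α in (-(π / 2))..(π / 2), g (ContinuousLinearMap.rotation α p)) ∂(μ.prod μ)
      = π * Complex.exp (-t) := by
    have : ∀ᵐ p ∂(μ.prod μ), (∫ α in (-(π / 2))..(π / 2), g (ContinuousLinearMap.rotation α p))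
        = π * Complex.exp (-t) := by
      filter_upwards [hne] with p hp
      rw [← angle_average w hw0 hw1 p.1 p.2 hp t ht]
      rfl
    rw [integral_congr_ae this]
    simp
  rw [hK, hI] at hJ
  exact mul_left_cancel₀ (by exact_mod_cast pi_ne_zero) hJ

theorem statement0 {m : ℕ} (hm : 2 ≤ m) (S : Matrix (Fin m) (Fin m) ℝ)
    (hS : S.PosSemidef) (hdiag : ∀ j, 0 < S j j)
    {Ω : Type*} [MeasurableSpace Ω] (P : Measure Ω) [IsProbabilityMeasure P]
    (X Y : Ω → Fin m → ℝ) (hX : Measurable X) (hY : Measurable Y)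
    (hXY : IndepFun X Y P)
    (hXlaw : IsMvGaussian S (P.map X)) (hYlaw : IsMvGaussian S (P.map Y))
    (w : Fin m → ℝ) (hw0 : ∀ j, 0 ≤ w j) (hw1 : ∑ j, w j = 1) :
    P.map (fun ω => ∑ j, w j * (X ω j / Y ω j)) = stdCauchy := by
  have hprod := hXY.map_prod_eq_prod_map_map hX.aemeasurable hY.aemeasurable
  rw [mv_unique hYlaw hXlaw] at hprod
  have hmap : P.map (fun ω => ∑ j, w j * (X ω j / Y ω j))
      = ((P.map X).prod (P.map X)).map (fun p => ∑ j, w j * (p.1 j / p.2 j)) := by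
    rw [← hprod, Measure.map_map (by fun_prop) (by fun_prop)]
    rfl
  have := hXlaw.1
  have hfin : IsFiniteMeasure (((P.map X).prod (P.map X)).map
      (fun p => ∑ j, w j * (p.1 j / p.2 j))) := inferInstance
  rw [hmap]
  apply Measure.ext_of_charFun
  have key : ∀ t : ℝ, 0 ≤ t → charFun (((P.map X).prod (P.map X)).map
      (fun p => ∑ j, w j * (p.1 j / p.2 j))) t = charFun stdCauchy t := fun t ht => by
    rw [charFun_main S hdiag _ hXlaw w hw0 hw1 t ht, charFun_stdCauchy t ht]
  ext t
  rcases le_total 0 t with ht | ht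
  · exact key t ht
  · have := key (-t) (by linarith)
    rw [charFun_neg, charFun_neg] at this
    exact (starRingEnd ℂ).injective this
end

section
/- Let m ≥ 2 and let Σ = (σ_ij) be an m×m positive semi-definite real matrix with σ_jj > 0 for all 1 ≤ j ≤ m. Let X = (X_1,…,X_m) and Y = (Y_1,…,Y_m) be independent random vectors, each distributed as N(0, Σ). Let w = (w_1,…,w_m) be a random vector, independent of (X,Y), satisfying almost surely w_j ≥ 0 for all j and w_1 + ⋯ + w_m = 1. Then Z = Σ_{j=1}^m w_j (X_j / Y_j) has the standard Cauchy distribution Cauchy(0,1). -/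
open MeasureTheory ProbabilityTheory Real

lemma cw_re_nonneg (z : ℂ) (hz : ‖z‖ ≤ 1) : 0 ≤ ((1 - z) / (1 + z)).re := by
  have h : z.re ^ 2 + z.im ^ 2 ≤ 1 := by
    have := Complex.sq_norm z
    rw [Complex.normSq_apply] at this
    nlinarith [norm_nonneg z]
  rw [Complex.div_re, ← add_div]
  apply div_nonneg _ (Complex.normSq_nonneg _)
  simp
  nlinarith

lemma cw_ne (c : ℂ) (hc : ‖c‖ = 1) (q : ℂ) (hq : ‖q‖ < 1) : 1 + c * q ≠ 0 := by
  intro h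
  have h1 : c * q = -1 := by linear_combination h
  have := congrArg norm h1
  simp [hc] at this
  linarith

lemma cw_norm_le {m : ℕ} (c : Fin m → ℂ) (hc : ∀ j, ‖c j‖ = 1) (w : Fin m → ℝ)
    (hw : ∀ j, 0 ≤ w j) (t : ℝ) (ht : 0 ≤ t) (q : ℂ) (hq : ‖q‖ ≤ 1) :
    ‖Complex.exp (-t * ∑ j, w j * ((1 - c j * q) / (1 + c j * q)))‖ ≤ 1 := by
  rw [Complex.norm_exp, Real.exp_le_one_iff, ← Complex.ofReal_neg, Complex.re_ofReal_mul,
    Complex.re_sum]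
  have : 0 ≤ ∑ j, ((w j : ℂ) * ((1 - c j * q) / (1 + c j * q))).re := by
    apply Finset.sum_nonneg
    intro j _
    rw [Complex.re_ofReal_mul]
    refine mul_nonneg (hw j) (cw_re_nonneg _ ?_)
    simpa [hc] using hq
  nlinarith

lemma cw_countable (c : ℂ) : {β : ℝ | 1 + c * Complex.exp (β * Complex.I) = 0}.Countable := by
  by_cases hne : {β : ℝ | 1 + c * Complex.exp (β * Complex.I) = 0}.Nonempty
  swap
  · rw [Set.not_nonempty_iff_eq_empty.1 hne]; exact Set.countable_empty
  obtain ⟨β₀, h₀⟩ := hne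
  refine (Set.countable_range (fun n : ℤ => β₀ + n * (2 * π))).mono ?_
  intro β hβ
  simp only [Set.mem_ofPred_eq] at h₀ hβ
  have hc : c ≠ 0 := by rintro rfl; simp at h₀
  have he : Complex.exp (β * Complex.I) = Complex.exp (β₀ * Complex.I) := by
    apply mul_left_cancel₀ hc
    linear_combination hβ - h₀
  obtain ⟨n, hn⟩ := Complex.exp_eq_exp_iff_exists_int.1 he
  refine ⟨n, ?_⟩
  have h2 : (β : ℂ) = β₀ + n * (2 * π) := by
    apply mul_right_cancel₀ Complex.I_ne_zero
    linear_combination hn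
  exact_mod_cast h2.symm

lemma cw_integral {m : ℕ} (c : Fin m → ℂ) (hc : ∀ j, ‖c j‖ = 1) (w : Fin m → ℝ)
    (hw : ∀ j, 0 ≤ w j) (hw1 : ∑ j, w j = 1) (t : ℝ) (ht : 0 ≤ t) :
    ∫ β in (0:ℝ)..(2 * π), Complex.exp (-t * ∑ j, w j *
      ((1 - c j * Complex.exp (β * Complex.I)) / (1 + c j * Complex.exp (β * Complex.I))))
      = 2 * π * Complex.exp (-t) := by
  set f : ℂ → ℂ := fun q => Complex.exp (-t * ∑ j, w j * ((1 - c j * q) / (1 + c j * q))) with hf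
  have hfm : Measurable f := by rw [hf]; fun_prop
  have hnorm : ∀ β : ℝ, ‖Complex.exp (β * Complex.I)‖ = 1 := Complex.norm_exp_ofReal_mul_I
  have key : ∀ r : ℝ, r ∈ Set.Ioo (0:ℝ) 1 →
      ∫ β in (0:ℝ)..(2 * π), f (r * Complex.exp (β * Complex.I)) = 2 * π * Complex.exp (-t) := by
    intro r hr
    have hd : DifferentiableOn ℂ f (Metric.closedBall 0 |r|) := by
      intro q hq
      have hq' : ‖q‖ < 1 := by
        rw [mem_closedBall_zero_iff, abs_of_pos hr.1] at hq
        linarith [hr.2]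
      have := fun j => cw_ne (c j) (hc j) q hq'
      apply DifferentiableAt.differentiableWithinAt
      rw [hf]
      fun_prop (disch := apply this)
    have h := (hd.diffContOnCl_ball subset_rfl).circleAverage
    rw [circleAverage_def] at h
    simp only [circleMap, zero_add] at h
    have h0 : f 0 = Complex.exp (-t) := by
      simp only [hf]
      simp [← Complex.ofReal_sum, hw1]
    rw [h0] at h
    rw [← h, Complex.real_smul, ← mul_assoc]
    push_cast
    rw [mul_inv_cancel₀ (by simp [pi_ne_zero]), one_mul]
  have lim : Filter.Tendsto (fun r : ℝ => ∫ β in (0:ℝ)..(2 * π), f (r * Complex.exp (β * Complex.I)))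
      (nhdsWithin 1 (Set.Iio 1)) (nhds (∫ β in (0:ℝ)..(2 * π), f (Complex.exp (β * Complex.I)))) := by
    have hev : ∀ᶠ r : ℝ in nhdsWithin 1 (Set.Iio 1), r ∈ Set.Ioo (0:ℝ) 1 :=
      Ioo_mem_nhdsLT (by norm_num)
    apply intervalIntegral.tendsto_integral_filter_of_dominated_convergence (fun _ => (1:ℝ))
    · refine Filter.Eventually.of_forall fun r => ?_
      exact (hfm.comp (by fun_prop)).aestronglyMeasurable
    · filter_upwards [hev] with r hr
      refine Filter.Eventually.of_forall fun β _ => ?_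
      apply cw_norm_le c hc w hw t ht
      rw [norm_mul, hnorm, mul_one, Complex.norm_real, Real.norm_eq_abs, abs_of_pos hr.1]
      exact hr.2.le
    · exact intervalIntegrable_const
    · have hcount : (⋃ j, {β : ℝ | 1 + c j * Complex.exp (β * Complex.I) = 0}).Countable :=
        Set.countable_iUnion fun j => cw_countable (c j)
      filter_upwards [hcount.ae_notMem volume] with β hβ _
      simp only [Set.mem_iUnion, Set.mem_ofPred_eq, not_exists] at hβ
      have hcont : ContinuousAt f (Complex.exp (β * Complex.I)) := by
        rw [hf]
        fun_prop (disch := apply hβ)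
      have h2 : Filter.Tendsto (fun r : ℝ => (r : ℂ) * Complex.exp (β * Complex.I))
          (nhds 1) (nhds (Complex.exp (β * Complex.I))) := by
        have : Continuous (fun r : ℝ => (r : ℂ) * Complex.exp (β * Complex.I)) := by fun_prop
        simpa using this.tendsto 1
      exact hcont.tendsto.comp (h2.mono_left nhdsWithin_le_nhds)
  have lim2 : Filter.Tendsto (fun r : ℝ => ∫ β in (0:ℝ)..(2 * π), f (r * Complex.exp (β * Complex.I)))
      (nhdsWithin 1 (Set.Iio 1)) (nhds (2 * π * Complex.exp (-t))) := by
    apply tendsto_const_nhds.congr'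
    filter_upwards [Ioo_mem_nhdsLT (show (0:ℝ) < 1 by norm_num)] with r hr
    exact (key r hr).symm
  exact tendsto_nhds_unique lim lim2

/-- Williams' lemma, averaged characteristic function form. -/
lemma cw_rot_nonneg {m : ℕ} (x y : Fin m → ℝ) (hy : ∀ j, y j ≠ 0) (w : Fin m → ℝ)
    (hw : ∀ j, 0 ≤ w j) (hw1 : ∑ j, w j = 1) (t : ℝ) (ht : 0 ≤ t) :
    ∫ β in (0:ℝ)..(2 * π), Complex.exp (((t * ∑ j, w j *
      ((cos (β / 2) * x j + sin (β / 2) * y j) / (cos (β / 2) * y j - sin (β / 2) * x j)) : ℝ) : ℂ)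
        * Complex.I) = 2 * π * Complex.exp (-t) := by
  set ζ : Fin m → ℂ := fun j => y j + x j * Complex.I with hζ
  have hζ0 : ∀ j, ζ j ≠ 0 := fun j h => hy j (by simpa [hζ] using congrArg Complex.re h)
  have hζs : ∀ j, (starRingEnd ℂ) (ζ j) ≠ 0 := fun j => by simpa using hζ0 j
  have hζc : ∀ j, (starRingEnd ℂ) (ζ j) = y j - x j * Complex.I := fun j => by
    simp [hζ, sub_eq_add_neg]
  rw [← cw_integral (fun j => ζ j / (starRingEnd ℂ) (ζ j)) (fun j => by
    rw [norm_div, RCLike.norm_conj, div_self (norm_ne_zero_iff.2 (hζ0 j))]) w hw hw1 t ht]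
  congr 1
  ext β
  congr 1
  push_cast
  rw [mul_assoc, neg_mul, ← mul_neg, Finset.sum_mul, ← Finset.sum_neg_distrib]
  congr 1
  refine Finset.sum_congr rfl fun j _ => ?_
  rw [mul_assoc, ← mul_neg]
  congr 1
  set C := Complex.cos (β / 2) with hC
  set D := Complex.sin (β / 2) with hD
  have hCD : C ^ 2 + D ^ 2 = 1 := Complex.cos_sq_add_sin_sq _
  have hE : Complex.exp (β * Complex.I) = (C + D * Complex.I) ^ 2 := by
    rw [hC, hD, ← Complex.exp_mul_I, ← Complex.exp_nat_mul]
    congr 1; push_cast; ring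
  have hu : (C - D * Complex.I) * (C + D * Complex.I) = 1 := by
    linear_combination hCD - D ^ 2 * Complex.I_sq
  have hu0 : C + D * Complex.I ≠ 0 := right_ne_zero_of_mul_eq_one hu
  set s := (starRingEnd ℂ) (ζ j) with hs
  have hs0 : s ≠ 0 := hζs j
  have hsv : s = y j - x j * Complex.I := hζc j
  have hq : ζ j = y j + x j * Complex.I := rfl
  rw [hE]
  have hI := Complex.I_sq
  have hk : (C + D * Complex.I) / s ≠ 0 := div_ne_zero hu0 hs0
  have e1 : 1 - ζ j / s * (C + D * Complex.I) ^ 2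
      = (-2 * Complex.I * (C * x j + D * y j)) * ((C + D * Complex.I) / s) := by
    field_simp
    rw [hsv, hq]
    linear_combination (-(y j - x j * Complex.I)) * hu
  have e2 : 1 + ζ j / s * (C + D * Complex.I) ^ 2
      = (2 * (C * y j - D * x j)) * ((C + D * Complex.I) / s) := by
    field_simp
    rw [hsv, hq]
    linear_combination (-(y j - x j * Complex.I)) * hu + (2 * D * x j * (C + D * Complex.I)) * hI
  rw [e1, e2, mul_div_mul_right _ _ hk]
  rw [show -2 * Complex.I * (C * x j + D * y j) = 2 * (-Complex.I * (C * x j + D * y j)) by ring,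
    mul_div_mul_left _ _ two_ne_zero]
  ring

lemma cw_rot {m : ℕ} (x y : Fin m → ℝ) (hy : ∀ j, y j ≠ 0) (w : Fin m → ℝ)
    (hw : ∀ j, 0 ≤ w j) (hw1 : ∑ j, w j = 1) (t : ℝ) :
    ∫ β in (0:ℝ)..(2 * π), Complex.exp (((t * ∑ j, w j *
      ((cos (β / 2) * x j + sin (β / 2) * y j) / (cos (β / 2) * y j - sin (β / 2) * x j)) : ℝ) : ℂ)
        * Complex.I) = 2 * π * Complex.exp (-|t|) := by
  rcases le_total 0 t with ht | ht
  · rw [cw_rot_nonneg x y hy w hw hw1 t ht, abs_of_nonneg ht]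
  · have h := congrArg (starRingEnd ℂ) (cw_rot_nonneg x y hy w hw hw1 (-t) (by linarith))
    rw [abs_of_nonpos ht]
    have h2 : (starRingEnd ℂ) (2 * π * Complex.exp (-(-t : ℝ))) = 2 * π * Complex.exp (-(-t : ℝ)) := by
      rw [map_mul, ← Complex.exp_conj]; simp [Complex.conj_ofNat]
    rw [h2] at h
    rw [← h, intervalIntegral.intervalIntegral_eq_integral_uIoc,
      intervalIntegral.intervalIntegral_eq_integral_uIoc]
    rw [if_pos (by positivity), one_smul, one_smul, ← integral_conj]
    congr 1
    ext β
    rw [← Complex.exp_conj, map_mul, Complex.conj_I, Complex.conj_ofReal]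
    push_cast
    congr 1
    ring

lemma stdCauchy_charFun (t : ℝ) : charFun stdCauchy t = Complex.exp (-|t|) := by
  rw [charFun_apply_real, stdCauchy, integral_withDensity_eq_integral_toReal_smul (by fun_prop) (by simp)]
  have himg : tan '' (Set.Ioo (-(π / 2)) (π / 2)) = Set.univ := Real.image_tan_Ioo
  rw [← setIntegral_univ, ← himg, integral_image_eq_integral_abs_deriv_smul measurableSet_Ioo
    (fun x hx => (Real.hasDerivAt_tan_of_mem_Ioo hx).hasDerivWithinAt) Real.injOn_tan]
  have h1 := cw_rot (m := 1) (fun _ => 0) (fun _ => 1) (by simp) (fun _ => 1) (by simp) (by simp) t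
  simp only [mul_zero, zero_add, mul_one, sub_zero, Finset.univ_unique, Finset.sum_const,
    Finset.card_singleton, one_smul, one_mul, ← Real.tan_eq_sin_div_cos] at h1
  set g : ℝ → ℂ := fun u => Complex.exp (((t * tan u : ℝ) : ℂ) * Complex.I) with hg
  have hper : Function.Periodic g π := fun u => by simp only [hg, Real.tan_periodic u]
  have h2 : ∫ u in (-(π / 2))..(π / 2), g u = π * Complex.exp (-|t|) := by
    have h3 := hper.intervalIntegral_add_eq (-(π / 2)) 0
    rw [show -(π / 2) + π = π / 2 by ring, zero_add] at h3
    rw [h3]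
    have h4 := intervalIntegral.integral_comp_div (a := 0) (b := 2 * π) g (two_ne_zero)
    simp only [zero_div] at h4
    rw [show 2 * π / 2 = π by ring] at h4
    change ∫ β in (0:ℝ)..(2 * π), g (β / 2) = _ at h1
    rw [h1, Complex.real_smul] at h4
    push_cast at h4
    apply mul_left_cancel₀ (two_ne_zero (α := ℂ))
    rw [← h4]; ring
  have h5 : ∫ u in (-(π / 2))..(π / 2), (π⁻¹ : ℂ) * g u = Complex.exp (-|t|) := by
    rw [intervalIntegral.integral_const_mul, h2]
    field_simp
  rw [← h5, intervalIntegral.integral_of_le (by linarith [pi_pos]), integral_Ioc_eq_integral_Ioo]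
  refine setIntegral_congr_fun measurableSet_Ioo fun u hu => ?_
  have hcos := Real.cos_pos_of_mem_Ioo hu
  have h6 : (1 + tan u ^ 2)⁻¹ = cos u ^ 2 := Real.inv_one_add_tan_sq hcos.ne'
  rw [ENNReal.toReal_ofReal (by positivity), h6, smul_smul, abs_of_nonneg (by positivity)]
  rw [show 1 / cos u ^ 2 * (π⁻¹ * cos u ^ 2) = π⁻¹ by field_simp, Complex.real_smul]
  simp [hg]

lemma cw_form_nonneg {m : ℕ} {S : Matrix (Fin m) (Fin m) ℝ} (hS : S.PosSemidef) (t : Fin m → ℝ) :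
    0 ≤ ∑ i, ∑ j, t i * S i j * t j := by
  have := hS.dotProduct_mulVec_nonneg t
  simpa [dotProduct, Matrix.mulVec, Finset.mul_sum, mul_assoc] using this

lemma cw_charFunDual {m : ℕ} {S : Matrix (Fin m) (Fin m) ℝ} (hS : S.PosSemidef)
    {μ : Measure (Fin m → ℝ)} (h : IsMvGaussian S μ) (L : StrongDual ℝ (Fin m → ℝ)) :
    charFunDual μ L = Complex.exp (((-(∑ i, ∑ j, L (Pi.single i 1) * S i j * L (Pi.single j 1)) / 2 : ℝ)) : ℂ) := by
  have hL : (L : (Fin m → ℝ) → ℝ) = fun x => ∑ i, L (Pi.single i 1) * x i := by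
    ext x
    conv_lhs => rw [pi_eq_sum_univ' x]
    rw [map_sum]
    refine Finset.sum_congr rfl fun i _ => ?_
    rw [map_smul, smul_eq_mul, mul_comm]
  rw [charFunDual_eq_charFun_map_one]
  have h3 := h.2 (fun i => L (Pi.single i 1))
  rw [← hL] at h3
  rw [h3, charFun_gaussianReal]
  congr 1
  rw [Real.coe_toNNReal _ (cw_form_nonneg hS _)]
  push_cast
  ring

noncomputable def cwRot (m : ℕ) (a b : ℝ) :
    ((Fin m → ℝ) × (Fin m → ℝ)) →L[ℝ] ((Fin m → ℝ) × (Fin m → ℝ)) :=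
  ContinuousLinearMap.prod
    (a • ContinuousLinearMap.fst ℝ (Fin m → ℝ) (Fin m → ℝ)
      + b • ContinuousLinearMap.snd ℝ (Fin m → ℝ) (Fin m → ℝ))
    (a • ContinuousLinearMap.snd ℝ (Fin m → ℝ) (Fin m → ℝ)
      - b • ContinuousLinearMap.fst ℝ (Fin m → ℝ) (Fin m → ℝ))

lemma cw_map_rot {m : ℕ} {S : Matrix (Fin m) (Fin m) ℝ} (hS : S.PosSemidef)
    {μ ν : Measure (Fin m → ℝ)} (h : IsMvGaussian S μ) (h' : IsMvGaussian S ν)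
    (a b : ℝ) (hab : a ^ 2 + b ^ 2 = 1) :
    (μ.prod ν).map (cwRot m a b) = μ.prod ν := by
  have := h.1
  have := h'.1
  have : IsProbabilityMeasure ((μ.prod ν).map (cwRot m a b)) :=
    Measure.isProbabilityMeasure_map (cwRot m a b).continuous.measurable.aemeasurable
  apply Measure.ext_of_charFunDual
  ext L
  rw [charFunDual_map, charFunDual_prod, charFunDual_prod, cw_charFunDual hS h, cw_charFunDual hS h',
    cw_charFunDual hS h, cw_charFunDual hS h', ← Complex.exp_add, ← Complex.exp_add,
    ← Complex.ofReal_add, ← Complex.ofReal_add]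
  congr 2
  rw [← add_div, ← add_div, ← neg_add, ← neg_add]
  congr 2
  have e1 : ∀ v : Fin m → ℝ, L (cwRot m a b (v, 0)) = a * L (v, 0) - b * L (0, v) := by
    intro v
    have : cwRot m a b (v, 0) = a • (v, 0) - b • (0, v) := by
      simp [cwRot]
    rw [this, map_sub, map_smul, map_smul]; simp
  have e2 : ∀ v : Fin m → ℝ, L (cwRot m a b (0, v)) = b * L (v, 0) + a * L (0, v) := by
    intro v
    have : cwRot m a b (0, v) = b • (v, 0) + a • (0, v) := by
      simp [cwRot]
    rw [this, map_add, map_smul, map_smul]; simp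
  simp only [ContinuousLinearMap.comp_apply, ContinuousLinearMap.inl_apply,
    ContinuousLinearMap.inr_apply, e1, e2, ← Finset.sum_add_distrib]
  refine Finset.sum_congr rfl fun i _ => Finset.sum_congr rfl fun j _ => ?_
  linear_combination (L (Pi.single i 1, 0) * S i j * L (Pi.single j 1, 0)
    + L (0, Pi.single i 1) * S i j * L (0, Pi.single j 1)) * hab

lemma cw_ne_zero {m : ℕ} {S : Matrix (Fin m) (Fin m) ℝ} (hdiag : ∀ j, 0 < S j j)
    {ν : Measure (Fin m → ℝ)} (h : IsMvGaussian S ν) : ∀ᵐ y ∂ν, ∀ j, y j ≠ 0 := by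
  rw [ae_all_iff]
  intro j
  have h1 := h.2 (Pi.single j 1)
  simp only [Pi.single_apply, ite_mul, one_mul, zero_mul, mul_ite, mul_one, mul_zero,
    Finset.sum_ite_eq', Finset.mem_univ, if_true] at h1
  have hn : (S j j).toNNReal ≠ 0 := by simpa using hdiag j
  have := nullSingletonClass_gaussianReal (μ := 0) hn
  have h2 : ∀ᵐ z ∂(ν.map (fun y => y j)), z ≠ 0 := by
    rw [h1]
    exact Measure.ae_ne _ _
  exact ae_of_ae_map (f := fun y : Fin m → ℝ => y j) (measurable_pi_apply j).aemeasurable h2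

lemma stdCauchy_prob : IsProbabilityMeasure stdCauchy := by
  have : stdCauchy = cauchyMeasure 0 1 := by
    rw [cauchyMeasure_of_scale_ne_zero _ one_ne_zero, stdCauchy]
    congr 1
    ext z
    simp [cauchyPDF, cauchyPDFReal, add_comm]
  rw [this]
  infer_instance

theorem statement1 {m : ℕ} (hm : 2 ≤ m) (S : Matrix (Fin m) (Fin m) ℝ)
    (hS : S.PosSemidef) (hdiag : ∀ j, 0 < S j j)
    {Ω : Type*} [MeasurableSpace Ω] (P : Measure Ω) [IsProbabilityMeasure P]
    (X Y : Ω → Fin m → ℝ) (hX : Measurable X) (hY : Measurable Y)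
    (hXY : IndepFun X Y P)
    (hXlaw : IsMvGaussian S (P.map X)) (hYlaw : IsMvGaussian S (P.map Y))
    (w : Ω → Fin m → ℝ) (hw : Measurable w)
    (hwXY : IndepFun w (fun ω => (X ω, Y ω)) P)
    (hw0 : ∀ᵐ ω ∂P, ∀ j, 0 ≤ w ω j) (hw1 : ∀ᵐ ω ∂P, ∑ j, w ω j = 1) :
    P.map (fun ω => ∑ j, w ω j * (X ω j / Y ω j)) = stdCauchy := by
  have := stdCauchy_prob
  have hXY' : Measurable fun ω => (X ω, Y ω) := hX.prodMk hY
  have hWXY' : Measurable fun ω => (w ω, (X ω, Y ω)) := hw.prodMk hXY'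
  have := Measure.isProbabilityMeasure_map (μ := P) hX.aemeasurable
  have := Measure.isProbabilityMeasure_map (μ := P) hY.aemeasurable
  have := Measure.isProbabilityMeasure_map (μ := P) hw.aemeasurable
  have hZm : Measurable fun ω => ∑ j, w ω j * (X ω j / Y ω j) := by fun_prop
  have := Measure.isProbabilityMeasure_map (μ := P) hZm.aemeasurable
  have hlaw : P.map (fun ω => (w ω, (X ω, Y ω)))
      = (P.map w).prod ((P.map X).prod (P.map Y)) := by
    rw [hwXY.map_prod_eq_prod_map_map hw.aemeasurable hXY'.aemeasurable,
      hXY.map_prod_eq_prod_map_map hX.aemeasurable hY.aemeasurable]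
  set Q := (P.map w).prod ((P.map X).prod (P.map Y)) with hQ
  apply Measure.ext_of_charFun
  ext t
  rw [stdCauchy_charFun, charFun_apply_real, integral_map hZm.aemeasurable (by fun_prop)]
  set G : ((Fin m → ℝ) × ((Fin m → ℝ) × (Fin m → ℝ))) → ℂ := fun p =>
    Complex.exp (((t * ∑ j, p.1 j * (p.2.1 j / p.2.2 j) : ℝ) : ℂ) * Complex.I) with hG
  have hGm : Measurable G := by rw [hG]; fun_prop
  have hstart : ∫ ω, Complex.exp (t * ((∑ j, w ω j * (X ω j / Y ω j) : ℝ) : ℂ) * Complex.I) ∂P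
      = ∫ p, G p ∂Q := by
    rw [← hlaw, integral_map hWXY'.aemeasurable hGm.aestronglyMeasurable]
    simp [hG]
  rw [hstart]
  -- rotated integrand
  set H : ℝ → ((Fin m → ℝ) × ((Fin m → ℝ) × (Fin m → ℝ))) → ℂ := fun β p =>
    Complex.exp (((t * ∑ j, p.1 j * ((cos (β / 2) * p.2.1 j + sin (β / 2) * p.2.2 j) /
      (cos (β / 2) * p.2.2 j - sin (β / 2) * p.2.1 j)) : ℝ) : ℂ) * Complex.I) with hH
  have hHm : Measurable (Function.uncurry H) := by
    simp only [hH, Function.uncurry_def]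
    fun_prop
  have hinv : ∀ β : ℝ, ∫ p, H β p ∂Q = ∫ p, G p ∂Q := by
    intro β
    have hr := cw_map_rot hS hXlaw hYlaw (cos (β / 2)) (sin (β / 2)) (Real.cos_sq_add_sin_sq _)
    have hrm : Measurable (cwRot m (cos (β / 2)) (sin (β / 2))) :=
      (cwRot m (cos (β / 2)) (sin (β / 2))).continuous.measurable
    have hQr : Q.map (Prod.map id (cwRot m (cos (β / 2)) (sin (β / 2)))) = Q := by
      rw [hQ, ← Measure.map_prod_map _ _ measurable_id hrm, hr, Measure.map_id]
    conv_rhs => rw [← hQr]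
    rw [integral_map (measurable_id.prodMap hrm).aemeasurable hGm.aestronglyMeasurable]
    rfl
  have hgood : ∀ᵐ p ∂Q, (∀ j, 0 ≤ p.1 j) ∧ (∑ j, p.1 j = 1) ∧ ∀ j, p.2.2 j ≠ 0 := by
    rw [← hlaw]
    have g1 : ∀ᵐ p ∂(P.map (fun ω => (w ω, (X ω, Y ω)))), ∀ j, 0 ≤ p.1 j := by
      rw [ae_all_iff]
      intro j
      rw [ae_map_iff hWXY'.aemeasurable (measurableSet_le (by fun_prop) (by fun_prop))]
      filter_upwards [hw0] with ω h using h j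
    have g2 : ∀ᵐ p ∂(P.map (fun ω => (w ω, (X ω, Y ω)))), ∑ j, p.1 j = 1 := by
      rw [ae_map_iff hWXY'.aemeasurable (measurableSet_eq_fun (by fun_prop) (by fun_prop))]
      exact hw1
    have g3 : ∀ᵐ p ∂(P.map (fun ω => (w ω, (X ω, Y ω)))), ∀ j, p.2.2 j ≠ 0 := by
      rw [hlaw, hQ]
      exact Measure.quasiMeasurePreserving_snd.ae
        (Measure.quasiMeasurePreserving_snd.ae (cw_ne_zero hdiag hYlaw))
    filter_upwards [g1, g2, g3] with p h1 h2 h3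
    exact ⟨h1, h2, h3⟩
  have hnorm : ∀ β p, ‖H β p‖ ≤ 1 := fun β p => (Complex.norm_exp_ofReal_mul_I _).le
  have : IsFiniteMeasure ((volume : Measure ℝ).restrict (Set.uIoc 0 (2 * π))) := by
    rw [Set.uIoc]; infer_instance
  have hint : Integrable (Function.uncurry H)
      ((volume.restrict (Set.uIoc 0 (2 * π))).prod Q) :=
    Integrable.of_bound hHm.aestronglyMeasurable 1 (Filter.Eventually.of_forall fun p => hnorm _ _)
  have hswap := MeasureTheory.intervalIntegral_integral_swap (f := H) hint
  have hl : ∫ β in (0:ℝ)..(2 * π), ∫ p, H β p ∂Q = 2 * π * ∫ p, G p ∂Q := by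
    simp [hinv]
  have hrr : ∫ p, (∫ β in (0:ℝ)..(2 * π), H β p) ∂Q = 2 * π * Complex.exp (-|t|) := by
    have : ∫ p, (∫ β in (0:ℝ)..(2 * π), H β p) ∂Q = ∫ p, (2 * π * Complex.exp (-|t|) : ℂ) ∂Q := by
      apply integral_congr_ae
      filter_upwards [hgood] with p hp
      exact cw_rot p.2.1 p.2.2 hp.2.2 p.1 hp.1 hp.2.1 t
    rw [this]; simp
  have h2pi : (2 * π : ℂ) ≠ 0 := by simp [pi_ne_zero]
  apply mul_left_cancel₀ h2pi
  rw [← hl, ← hrr, hswap]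
end

section
/- Let m ≥ 1, let Σ = (σ_ij) be an m×m positive semi-definite real matrix with σ_jj > 0 for all 1 ≤ j ≤ m, and let X = (X_1,…,X_m) ~ N(0, Σ). Let q(x_1,…,x_m) = x_1^{a_1} ⋯ x_m^{a_m} with nonnegative real exponents a_1,…,a_m such that a_1 + ⋯ + a_m > 0. Then the Wald statistic W_{q,Σ}(X) = q(X)^2 / (∇q(X) Σ ∇q(X)ᵀ) is distributed as (a_1 + ⋯ + a_m)^{-2} · χ²_1, i.e., as (Σ_j a_j)^{-2} times a chi-squared random variable with one degree of freedom. -/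
open MeasureTheory ProbabilityTheory Real

/-- For `q(x) = x₁^{a₁} ⋯ x_m^{a_m}`, the Wald statistic
`W_{q,Σ}(x) = q(x)² / (∇q(x) Σ ∇q(x)ᵀ) = {∇[log q(x)] Σ ∇[log q(x)]ᵀ}⁻¹`,
where `∇[log q(x)] = (a₁/x₁, …, a_m/x_m)`. -/
noncomputable def waldStat {m : ℕ} (S : Matrix (Fin m) (Fin m) ℝ) (a : Fin m → ℝ)
    (x : Fin m → ℝ) : ℝ :=
  (∑ i, ∑ j, (a i / x i) * S i j * (a j / x j))⁻¹


open Complex in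
/-- Power series expansion of the characteristic function of a bounded random variable. -/
lemma hasSum_charFun_bounded {C : Type*} [MeasurableSpace C] (ρ : Measure C)
    [IsProbabilityMeasure ρ] (U : C → ℝ) (hU : Measurable U) (hU1 : ∀ x, |U x| ≤ 1) (t : ℝ) :
    HasSum (fun n : ℕ => ((t * I) ^ n / (n.factorial : ℂ)) * ((∫ x, U x ^ n ∂ρ : ℝ) : ℂ))
      (∫ x, cexp (t * U x * I) ∂ρ) := by
  have hb : ∀ (n : ℕ) (x : C),
      ‖((t * I) ^ n / (n.factorial : ℂ)) * ((U x : ℂ) ^ n)‖ ≤ |t| ^ n / n.factorial := by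
    intro n x
    simp only [norm_mul, norm_div, norm_pow, norm_I, mul_one, norm_real, Complex.norm_natCast,
      Real.norm_eq_abs]
    exact mul_le_of_le_one_right (by positivity) (pow_le_one₀ (abs_nonneg _) (hU1 x))
  have := hasSum_integral_of_dominated_convergence (μ := ρ)
    (F := fun (n : ℕ) x => ((t * I) ^ n / (n.factorial : ℂ)) * ((U x : ℂ) ^ n))
    (f := fun x => cexp (t * U x * I)) (fun n _ => |t| ^ n / n.factorial)
    (fun n => by
      apply Measurable.aestronglyMeasurable
      fun_prop)
    (fun n => Filter.Eventually.of_forall (hb n))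
    (Filter.Eventually.of_forall fun x => Real.summable_pow_div_factorial _)
    (by simp)
    (Filter.Eventually.of_forall fun x => by
      have := NormedSpace.expSeries_div_hasSum_exp (𝔸 := ℂ) (t * U x * I)
      rw [← Complex.exp_eq_exp_ℂ] at this
      have e : (fun n : ℕ => ((t * I) ^ n / (n.factorial : ℂ)) * ((U x : ℂ) ^ n))
          = fun n : ℕ => (t * U x * I) ^ n / (n.factorial : ℂ) := by
        funext n; ring
      rw [e]
      exact this)
  have e : (fun n : ℕ => ((t * I) ^ n / (n.factorial : ℂ)) * ((∫ x, U x ^ n ∂ρ : ℝ) : ℂ))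
      = fun n : ℕ => ∫ x, ((t * I) ^ n / (n.factorial : ℂ)) * ((U x : ℂ) ^ n) ∂ρ := by
    funext n
    rw [integral_const_mul, ← integral_complex_ofReal]
    simp
  rw [e]
  exact this

open Complex in
/-- Two bounded random variables with values in `[0,1]` and equal moments have the same law. -/
lemma map_eq_of_moments {A B : Type*} [MeasurableSpace A] [MeasurableSpace B]
    (μ : Measure A) (ν : Measure B) [IsProbabilityMeasure μ] [IsProbabilityMeasure ν]
    (V : A → ℝ) (W : B → ℝ) (hV : Measurable V) (hW : Measurable W)
    (hV1 : ∀ x, |V x| ≤ 1) (hW1 : ∀ x, |W x| ≤ 1)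
    (h : ∀ n : ℕ, ∫ x, V x ^ n ∂μ = ∫ x, W x ^ n ∂ν) :
    μ.map V = ν.map W := by
  have := Measure.isProbabilityMeasure_map (μ := μ) hV.aemeasurable
  have := Measure.isProbabilityMeasure_map (μ := ν) hW.aemeasurable
  apply Measure.ext_of_charFun
  ext t
  rw [charFun_apply_real, charFun_apply_real, integral_map hV.aemeasurable (by
    apply Measurable.aestronglyMeasurable; fun_prop), integral_map hW.aemeasurable (by
    apply Measurable.aestronglyMeasurable; fun_prop)]
  have h1 := hasSum_charFun_bounded μ V hV hV1 t
  have h2 := hasSum_charFun_bounded ν W hW hW1 t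
  simp_rw [h] at h1
  exact h1.unique h2

open Complex in
/-- The rotated direction `z / conj z`. -/
noncomputable def dirC (x y : ℝ) : ℂ := (x + y * I) / (x - y * I)

open Complex in
noncomputable def waldF {m : ℕ} (a : Fin m → ℝ) (l : ℝ)
    (p : (Fin m → ℝ) × (Fin m → ℝ)) (w : ℂ) : ℂ :=
  cexp (l * ∑ j, (a j : ℂ) * ((w * dirC (p.1 j) (p.2 j) - 1) / (w * dirC (p.1 j) (p.2 j) + 1)))

open Complex in
lemma norm_dirC_le (x y : ℝ) : ‖dirC x y‖ ≤ 1 := by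
  have : (x - y * I : ℂ) = (starRingEnd ℂ) (x + y * I) := by simp [sub_eq_add_neg]
  rw [dirC, this, norm_div, Complex.norm_conj]
  exact div_self_le_one _

lemma re_cayley_le (u : ℂ) (hu : ‖u‖ ≤ 1) : ((u - 1) / (u + 1)).re ≤ 0 := by
  have h : u.re * u.re + u.im * u.im ≤ 1 := by
    have := Complex.normSq_eq_norm_sq u
    rw [Complex.normSq_apply] at this
    rw [this]
    exact pow_le_one₀ (norm_nonneg _) hu
  rw [Complex.div_re]
  rw [← add_div]
  apply div_nonpos_of_nonpos_of_nonneg _ (Complex.normSq_nonneg _)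
  simp
  nlinarith

lemma norm_waldF_le {m : ℕ} (a : Fin m → ℝ) (ha : ∀ j, 0 ≤ a j) (l : ℝ) (hl : 0 ≤ l)
    (p : (Fin m → ℝ) × (Fin m → ℝ)) (w : ℂ) (hw : ‖w‖ ≤ 1) : ‖waldF a l p w‖ ≤ 1 := by
  rw [waldF, Complex.norm_exp, Real.exp_le_one_iff, Complex.re_ofReal_mul, Complex.re_sum]
  apply mul_nonpos_of_nonneg_of_nonpos hl
  apply Finset.sum_nonpos
  intro j _
  rw [Complex.re_ofReal_mul]
  apply mul_nonpos_of_nonneg_of_nonpos (ha j)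
  apply re_cayley_le
  rw [norm_mul]
  exact mul_le_one₀ hw (norm_nonneg _) (norm_dirC_le _ _)

lemma waldF_zero {m : ℕ} (a : Fin m → ℝ) (l : ℝ) (p : (Fin m → ℝ) × (Fin m → ℝ)) :
    waldF a l p 0 = Complex.exp (-(l * ∑ j, a j : ℝ)) := by
  simp [waldF]

lemma waldF_circleAverage {m : ℕ} (a : Fin m → ℝ) (l : ℝ) (p : (Fin m → ℝ) × (Fin m → ℝ))
    (r : ℝ) (hr0 : 0 ≤ r) (hr : r < 1) :
    circleAverage (waldF a l p) 0 r = waldF a l p 0 := by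
  have hd : ∀ w ∈ Metric.closedBall (0 : ℂ) |r|, DifferentiableAt ℂ (waldF a l p) w := by
    intro w hw
    have hw : ‖w‖ < 1 := by
      rw [mem_closedBall_zero_iff, abs_of_nonneg hr0] at hw
      linarith
    have hne : ∀ j, w * dirC (p.1 j) (p.2 j) + 1 ≠ 0 := by
      intro j h
      have h2 : w * dirC (p.1 j) (p.2 j) = -1 := by linear_combination h
      have h3 : ‖w * dirC (p.1 j) (p.2 j)‖ = 1 := by rw [h2]; simp
      rw [norm_mul] at h3
      nlinarith [norm_nonneg w, norm_nonneg (dirC (p.1 j) (p.2 j)), norm_dirC_le (p.1 j) (p.2 j)]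
    unfold waldF
    apply DifferentiableAt.cexp
    apply DifferentiableAt.const_mul
    apply DifferentiableAt.fun_sum
    intro j _
    apply DifferentiableAt.const_mul
    exact DifferentiableAt.fun_div (by fun_prop) (by fun_prop) (hne j)
  apply circleAverage_of_differentiable_on_off_countable Set.countable_empty
  · exact fun w hw => (hd w hw).continuousAt.continuousWithinAt
  · exact fun w hw => hd w (Metric.ball_subset_closedBall hw.1)

open Complex in
lemma waldF_rotation {m : ℕ} (a : Fin m → ℝ) (l : ℝ) (p : (Fin m → ℝ) × (Fin m → ℝ))
    (r φ : ℝ) :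
    waldF a l (ContinuousLinearMap.rotation (-φ / 2) p) r = waldF a l p (circleMap 0 r φ) := by
  have h : ∀ x y : ℝ, dirC (Real.cos (-φ / 2) * x + Real.sin (-φ / 2) * y)
      (-Real.sin (-φ / 2) * x + Real.cos (-φ / 2) * y) = cexp (φ * I) * dirC x y := by
    intro x y
    have e1 : cexp (φ * I) = cexp (φ / 2 * I) / cexp (-(φ / 2 * I)) := by
      rw [← Complex.exp_sub]; congr 1; ring
    rw [dirC, dirC, e1, div_mul_div_comm]
    have c1 : cexp (φ / 2 * I) = Complex.cos (φ / 2) + Complex.sin (φ / 2) * I :=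
      Complex.exp_mul_I _
    have c2 : cexp (-(φ / 2 * I)) = Complex.cos (φ / 2) - Complex.sin (φ / 2) * I := by
      rw [← neg_mul, Complex.exp_mul_I]; simp [sub_eq_add_neg]
    rw [c1, c2, neg_div]
    congr 1
    · simp
      linear_combination (-Complex.sin (φ / 2) * y) * I_sq
    · simp
      linear_combination (-Complex.sin (φ / 2) * y) * I_sq
  unfold waldF
  congr 2
  apply Finset.sum_congr rfl
  intro j _
  have := h (p.1 j) (p.2 j)
  rw [ContinuousLinearMap.rotation_apply]
  simp only [Pi.add_apply, Pi.smul_apply, smul_eq_mul]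
  rw [this, circleMap_zero]
  rw [mul_assoc]

lemma measurable_waldF {m : ℕ} (a : Fin m → ℝ) (l : ℝ) :
    Measurable (fun q : ((Fin m → ℝ) × (Fin m → ℝ)) × ℂ => waldF a l q.1 q.2) := by
  unfold waldF dirC
  fun_prop

lemma aesm_waldF {m : ℕ} (a : Fin m → ℝ) (l : ℝ) (w : ℂ)
    (ρ : Measure ((Fin m → ℝ) × (Fin m → ℝ))) :
    AEStronglyMeasurable (fun p => waldF a l p w) ρ := by
  apply Measurable.aestronglyMeasurable
  unfold waldF dirC
  fun_prop

lemma aesm_waldF_circle {m : ℕ} (a : Fin m → ℝ) (l r : ℝ)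
    (ρ : Measure (ℝ × ((Fin m → ℝ) × (Fin m → ℝ)))) :
    AEStronglyMeasurable (Function.uncurry fun φ p => waldF a l p (circleMap 0 r φ)) ρ := by
  apply Measurable.aestronglyMeasurable
  unfold waldF dirC circleMap Function.uncurry
  fun_prop

lemma isMvGaussian_dual {m : ℕ} {S : Matrix (Fin m) (Fin m) ℝ} {μ : Measure (Fin m → ℝ)}
    (h : IsMvGaussian S μ) (L : StrongDual ℝ (Fin m → ℝ)) :
    ∃ v, μ.map L = gaussianReal 0 v := by
  have hL : μ.map L = μ.map (fun x => ∑ i, L (Pi.single i 1) * x i) := by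
    congr 1
    ext x
    conv_lhs => rw [← LinearMap.sum_single_apply (fun _ => ℝ) x]
    rw [map_sum]
    apply Finset.sum_congr rfl
    intro i _
    rw [mul_comm, ← smul_eq_mul, ← map_smul, ← Pi.single_smul]
    simp
  exact ⟨_, hL.trans (h.2 _)⟩

lemma isMvGaussian_integral {m : ℕ} {S : Matrix (Fin m) (Fin m) ℝ} {μ : Measure (Fin m → ℝ)}
    (h : IsMvGaussian S μ) (L : StrongDual ℝ (Fin m → ℝ)) : ∫ x, L x ∂μ = 0 := by
  obtain ⟨v, hv⟩ := isMvGaussian_dual h L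
  have h1 : ∫ x, x ∂(μ.map L) = ∫ x, L x ∂μ :=
    integral_map (by fun_prop) (by fun_prop)
  rw [← h1, hv, integral_id_gaussianReal]

lemma isMvGaussian_isGaussian {m : ℕ} {S : Matrix (Fin m) (Fin m) ℝ} {μ : Measure (Fin m → ℝ)}
    (h : IsMvGaussian S μ) : IsGaussian μ := by
  constructor
  intro L
  obtain ⟨v, hv⟩ := isMvGaussian_dual h L
  have h1 : Var[L; μ] = v := by
    have := variance_map (X := fun x : ℝ => x) (μ := μ) (Y := L) (by fun_prop) (by fun_prop)
    rw [hv, variance_fun_id_gaussianReal] at this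
    exact this.symm
  rw [isMvGaussian_integral h L, h1, hv, Real.toNNReal_coe]

lemma isMvGaussian_rotation {m : ℕ} {S : Matrix (Fin m) (Fin m) ℝ} {μ : Measure (Fin m → ℝ)}
    (h : IsMvGaussian S μ) (θ : ℝ) :
    (μ.prod μ).map (ContinuousLinearMap.rotation θ) = μ.prod μ := by
  have := isMvGaussian_isGaussian h
  exact IsGaussian.map_rotation_eq_self_of_forall_strongDual_eq_zero (isMvGaussian_integral h) θ

lemma isMvGaussian_ne_zero {m : ℕ} {S : Matrix (Fin m) (Fin m) ℝ} {μ : Measure (Fin m → ℝ)}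
    (h : IsMvGaussian S μ) (hdiag : ∀ j, 0 < S j j) : ∀ᵐ x ∂μ, ∀ j, x j ≠ 0 := by
  rw [ae_all_iff]
  intro j
  have h1 := h.2 (Pi.single j 1)
  have hv : (∑ i, ∑ k, (Pi.single j 1 : Fin m → ℝ) i * S i k * (Pi.single j 1 : Fin m → ℝ) k)
      = S j j := by
    simp [Pi.single_apply]
  have hf : (fun x : Fin m → ℝ => ∑ i, (Pi.single j 1 : Fin m → ℝ) i * x i) = fun x => x j := by
    ext x; simp [Pi.single_apply]
  rw [hv, hf] at h1
  have := nullSingletonClass_gaussianReal (μ := 0) (v := (S j j).toNNReal) (by simpa using hdiag j)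
  have h2 : ∀ᵐ y ∂(μ.map (fun x : Fin m → ℝ => x j)), y ≠ 0 := by
    rw [h1]
    exact Measure.ae_ne _ 0
  exact ae_of_ae_map (f := fun x : Fin m → ℝ => x j) (p := fun y => y ≠ 0)
    (measurable_pi_apply j).aemeasurable h2

/-- The averaged function is constant inside the disc. -/
lemma integral_waldF {m : ℕ} {S : Matrix (Fin m) (Fin m) ℝ} {μ : Measure (Fin m → ℝ)}
    (h : IsMvGaussian S μ) (a : Fin m → ℝ) (ha : ∀ j, 0 ≤ a j) (l : ℝ) (hl : 0 ≤ l)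
    (r : ℝ) (hr0 : 0 ≤ r) (hr : r < 1) :
    ∫ p, waldF a l p r ∂(μ.prod μ) = Complex.exp (-(l * ∑ j, a j : ℝ)) := by
  have := h.1
  have h1 : ∀ φ : ℝ, ∫ p, waldF a l p (circleMap 0 r φ) ∂(μ.prod μ)
      = ∫ p, waldF a l p r ∂(μ.prod μ) := by
    intro φ
    conv_rhs => rw [← isMvGaussian_rotation h (-φ / 2)]
    rw [integral_map (by fun_prop) (aesm_waldF a l _ _)]
    simp_rw [waldF_rotation]
  have h2 : ∫ φ in 0..2 * π, ∫ p, waldF a l p (circleMap 0 r φ) ∂(μ.prod μ)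
      = ∫ p, (∫ φ in 0..2 * π, waldF a l p (circleMap 0 r φ)) ∂(μ.prod μ) := by
    apply intervalIntegral_integral_swap
    have : IsFiniteMeasure (volume.restrict (Set.uIoc 0 (2 * π))) := ⟨by simp [Set.uIoc]⟩
    apply Integrable.of_bound (C := 1)
    · exact aesm_waldF_circle a l r _
    · refine Filter.Eventually.of_forall fun q => ?_
      apply norm_waldF_le a ha l hl
      simp [abs_of_nonneg hr0, hr.le]
  have h3 : ∀ p : (Fin m → ℝ) × (Fin m → ℝ), ∫ φ in 0..2 * π, waldF a l p (circleMap 0 r φ)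
      = (2 * π) • Complex.exp (-(l * ∑ j, a j : ℝ)) := by
    intro p
    have := waldF_circleAverage a l p r hr0 hr
    rw [waldF_zero, Real.circleAverage_def] at this
    rw [← this, smul_smul, mul_inv_cancel₀ (by positivity), one_smul]
  simp_rw [h1, h3] at h2
  simp only [intervalIntegral.integral_const, integral_const, sub_zero, probReal_univ,
    one_smul] at h2
  exact smul_right_injective ℂ (by positivity : (2 * π) ≠ 0) h2

open Complex in
lemma waldF_one {m : ℕ} (a : Fin m → ℝ) (l : ℝ) (x y : Fin m → ℝ) (hx : ∀ j, x j ≠ 0) :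
    waldF a l (x, y) 1 = cexp (l * (∑ j, a j / x j * y j : ℝ) * I) := by
  unfold waldF
  rw [mul_assoc]
  congr 2
  push_cast
  rw [Finset.sum_mul]
  apply Finset.sum_congr rfl
  intro j _
  have hx' : (x j : ℂ) ≠ 0 := by exact_mod_cast hx j
  have hz : (x j - y j * I : ℂ) ≠ 0 := by
    intro h0
    have := congrArg Complex.re h0
    simp at this
    exact hx j this
  have h2 : dirC (x j) (y j) + 1 = 2 * x j / (x j - y j * I) := by
    rw [dirC]; field_simp; ring
  have h3 : dirC (x j) (y j) - 1 = 2 * y j * I / (x j - y j * I) := by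
    rw [dirC]; field_simp; ring
  simp only [one_mul]
  rw [h2, h3]
  field_simp

lemma integral_waldF_one {m : ℕ} {S : Matrix (Fin m) (Fin m) ℝ} {μ : Measure (Fin m → ℝ)}
    (h : IsMvGaussian S μ) (hdiag : ∀ j, 0 < S j j)
    (a : Fin m → ℝ) (ha : ∀ j, 0 ≤ a j) (l : ℝ) (hl : 0 ≤ l) :
    ∫ p, waldF a l p 1 ∂(μ.prod μ) = Complex.exp (-(l * ∑ j, a j : ℝ)) := by
  have := h.1
  let r : ℕ → ℝ := fun n => 1 - 1 / ((n : ℝ) + 1)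
  have hr0 : ∀ n, 0 ≤ r n := fun n => by
    have : 1 / ((n : ℝ) + 1) ≤ 1 := by
      rw [div_le_one (by positivity)]; linarith [Nat.cast_nonneg (α := ℝ) n]
    simp only [r]; linarith
  have hr1 : ∀ n, r n < 1 := fun n => by
    have : 0 < 1 / ((n : ℝ) + 1) := by positivity
    simp only [r]; linarith
  have hrt : Filter.Tendsto (fun n => ((r n : ℝ) : ℂ)) Filter.atTop (nhds 1) := by
    have : Filter.Tendsto r Filter.atTop (nhds (1 - 0)) :=
      tendsto_const_nhds.sub tendsto_one_div_add_atTop_nhds_zero_nat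
    rw [sub_zero] at this
    exact_mod_cast (Complex.continuous_ofReal.tendsto 1).comp this
  have hae : ∀ᵐ p ∂(μ.prod μ), ∀ j, p.1 j ≠ 0 :=
    Measure.quasiMeasurePreserving_fst.ae (isMvGaussian_ne_zero h hdiag)
  have ht : Filter.Tendsto (fun n => ∫ p, waldF a l p (r n) ∂(μ.prod μ)) Filter.atTop
      (nhds (∫ p, waldF a l p 1 ∂(μ.prod μ))) := by
    apply tendsto_integral_of_dominated_convergence (fun _ => 1)
    · intro n
      exact aesm_waldF a l _ _
    · simp
    · intro n
      refine Filter.Eventually.of_forall fun q => ?_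
      apply norm_waldF_le a ha l hl
      simp [abs_of_nonneg (hr0 n), (hr1 n).le]
    · filter_upwards [hae] with p hp
      have hc : ContinuousAt (waldF a l p) 1 := by
        unfold waldF
        apply ContinuousAt.cexp
        apply ContinuousAt.mul continuousAt_const
        apply tendsto_finsetSum
        intro j _
        apply ContinuousAt.mul continuousAt_const
        apply ContinuousAt.div₀ (by fun_prop) (by fun_prop)
        have hz : (p.1 j - p.2 j * Complex.I : ℂ) ≠ 0 := by
          intro h0
          have := congrArg Complex.re h0
          simp at this
          exact hp j this
        have h2 : dirC (p.1 j) (p.2 j) + 1 = 2 * p.1 j / (p.1 j - p.2 j * Complex.I) := by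
          rw [dirC]; field_simp; ring
        rw [one_mul, h2]
        apply div_ne_zero _ hz
        have := hp j
        simpa using this
      exact hc.tendsto.comp hrt
  simp_rw [integral_waldF h a ha l hl _ (hr0 _) (hr1 _)] at ht
  exact (tendsto_nhds_unique ht tendsto_const_nhds)

/-- Laplace transform of the quadratic form. -/
lemma laplace_quad {m : ℕ} {S : Matrix (Fin m) (Fin m) ℝ} (hS : S.PosSemidef)
    {μ : Measure (Fin m → ℝ)} (h : IsMvGaussian S μ) (hdiag : ∀ j, 0 < S j j)
    (a : Fin m → ℝ) (ha : ∀ j, 0 ≤ a j) (l : ℝ) (hl : 0 ≤ l) :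
    ∫ x, Real.exp (-(l ^ 2 * (waldStat S a x)⁻¹ / 2)) ∂μ = Real.exp (-(l * ∑ j, a j)) := by
  have := h.1
  have h1 := integral_waldF_one h hdiag a ha l hl
  rw [integral_prod] at h1
  rotate_left
  · apply Integrable.of_bound (C := 1)
    · exact aesm_waldF a l _ _
    · refine Filter.Eventually.of_forall fun q => ?_
      apply norm_waldF_le a ha l hl
      simp
  have h2 : ∀ᵐ x ∂μ, ∫ y, waldF a l (x, y) 1 ∂μ
      = ((Real.exp (-(l ^ 2 * (waldStat S a x)⁻¹ / 2)) : ℝ) : ℂ) := by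
    filter_upwards [isMvGaussian_ne_zero h hdiag] with x hx
    simp_rw [waldF_one a l x _ hx]
    have h3 := h.2 (fun j => a j / x j)
    have h4 := congrArg (fun ν => charFun ν l) h3
    simp only [charFun_gaussianReal] at h4
    rw [charFun_apply_real, integral_map (Measurable.aemeasurable (by fun_prop)) (by
      apply Measurable.aestronglyMeasurable; fun_prop)] at h4
    rw [h4]
    have hq : 0 ≤ ∑ i, ∑ j, a i / x i * S i j * (a j / x j) := by
      have := hS.dotProduct_mulVec_nonneg (fun j => a j / x j)
      simp only [dotProduct, Matrix.mulVec, Finset.mul_sum, Pi.star_apply, star_trivial] at this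
      simpa only [mul_assoc] using this
    rw [Real.coe_toNNReal _ hq, waldStat, inv_inv]
    push_cast
    congr 1
    ring
  rw [integral_congr_ae h2, integral_complex_ofReal, ← Complex.ofReal_neg,
    ← Complex.ofReal_exp] at h1
  exact_mod_cast h1

lemma measurable_waldStat {m : ℕ} (S : Matrix (Fin m) (Fin m) ℝ) (a : Fin m → ℝ) :
    Measurable (waldStat S a) := by
  unfold waldStat
  fun_prop

lemma waldStat_nonneg {m : ℕ} {S : Matrix (Fin m) (Fin m) ℝ} (hS : S.PosSemidef)
    (a x : Fin m → ℝ) : 0 ≤ waldStat S a x := by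
  have := hS.dotProduct_mulVec_nonneg (fun j => a j / x j)
  simp only [dotProduct, Matrix.mulVec, Finset.mul_sum, Pi.star_apply, star_trivial] at this
  rw [waldStat, inv_nonneg]
  simpa only [mul_assoc] using this

/-- The law of the Wald statistic only depends on `∑ j, a j`. -/
lemma waldStat_law_eq {m k : ℕ} {S : Matrix (Fin m) (Fin m) ℝ} {T : Matrix (Fin k) (Fin k) ℝ}
    (hS : S.PosSemidef) (hT : T.PosSemidef)
    {μ : Measure (Fin m → ℝ)} {ν : Measure (Fin k → ℝ)}
    (hμ : IsMvGaussian S μ) (hν : IsMvGaussian T ν)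
    (hdS : ∀ j, 0 < S j j) (hdT : ∀ j, 0 < T j j)
    (a : Fin m → ℝ) (ha : ∀ j, 0 ≤ a j) (b : Fin k → ℝ) (hb : ∀ j, 0 ≤ b j)
    (hab : ∑ j, a j = ∑ j, b j) :
    μ.map (waldStat S a) = ν.map (waldStat T b) := by
  have := hμ.1
  have := hν.1
  have hmS := measurable_waldStat S a
  have hmT := measurable_waldStat T b
  have key := map_eq_of_moments μ ν (fun x => Real.exp (-(waldStat S a x)⁻¹))
    (fun x => Real.exp (-(waldStat T b x)⁻¹)) (by fun_prop) (by fun_prop)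
    (fun x => by
      rw [abs_of_pos (Real.exp_pos _), Real.exp_le_one_iff, neg_nonpos, inv_nonneg]
      exact waldStat_nonneg hS a x)
    (fun x => by
      rw [abs_of_pos (Real.exp_pos _), Real.exp_le_one_iff, neg_nonpos, inv_nonneg]
      exact waldStat_nonneg hT b x)
    (fun n => by
      have hl : (√(2 * n)) ^ 2 = 2 * n := Real.sq_sqrt (by positivity)
      have e1 := laplace_quad hS hμ hdS a ha (√(2 * n)) (by positivity)
      have e2 := laplace_quad hT hν hdT b hb (√(2 * n)) (by positivity)
      rw [hl] at e1 e2
      rw [hab, ← e2] at e1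
      convert e1 using 3 with x x
      · rw [← Real.exp_nat_mul]; congr 1; ring
      · rw [← Real.exp_nat_mul]; congr 1; ring)
  have key2 := congrArg (fun ρ => ρ.map (fun v : ℝ => (-Real.log v)⁻¹)) key
  rw [Measure.map_map (by fun_prop) (by fun_prop), Measure.map_map (by fun_prop) (by fun_prop)]
    at key2
  simpa [Function.comp_def] using key2

theorem statement2 {m : ℕ} (hm : 1 ≤ m) (S : Matrix (Fin m) (Fin m) ℝ)
    (hS : S.PosSemidef) (hdiag : ∀ j, 0 < S j j)
    {Ω : Type*} [MeasurableSpace Ω] (P : Measure Ω) [IsProbabilityMeasure P]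
    (X : Ω → Fin m → ℝ) (hX : Measurable X) (hXlaw : IsMvGaussian S (P.map X))
    (a : Fin m → ℝ) (ha : ∀ j, 0 ≤ a j) (hsum : 0 < ∑ j, a j) :
    -- `W_{q,Σ}(X)` is distributed as `(∑ j, a j)⁻² · χ²₁`, where `χ²₁` is the
    -- distribution of the square of a standard normal random variable.
    P.map (fun ω => waldStat S a (X ω)) =
      (gaussianReal 0 1).map (fun z => ((∑ j, a j) ^ 2)⁻¹ * z ^ 2) := by
  have hc : Measurable (fun (z : ℝ) (_ : Fin 1) => z) := by fun_prop
  have hν : IsMvGaussian (1 : Matrix (Fin 1) (Fin 1) ℝ)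
      ((gaussianReal 0 1).map (fun (z : ℝ) (_ : Fin 1) => z)) := by
    refine ⟨Measure.isProbabilityMeasure_map hc.aemeasurable, fun t => ?_⟩
    rw [Measure.map_map (by fun_prop) hc]
    have := gaussianReal_map_const_mul (μ := 0) (v := 1) (t 0)
    simp only [Function.comp_def, Finset.univ_unique, Fin.default_eq_zero, Finset.sum_singleton]
    rw [this]
    congr 1
    · simp
    · ext
      simp [← pow_two, Real.coe_toNNReal _ (sq_nonneg _)]
  have h1 := waldStat_law_eq hS Matrix.PosSemidef.one hXlaw hν hdiag (by simp) a ha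
    (fun _ => ∑ j, a j) (fun _ => hsum.le) (by simp)
  rw [Measure.map_map (measurable_waldStat _ _) hX,
    Measure.map_map (measurable_waldStat _ _) hc] at h1
  change P.map (waldStat S a ∘ X) = _
  rw [h1]
  congr 1
  ext z
  simp [waldStat]
  field_simp
end

section
/- Let m ≥ 2 and let Σ be an m×m strictly positive definite real matrix. Let X = (X_1,…,X_m) and Y = (Y_1,…,Y_m) be independent random vectors, each distributed as N(0, Σ). For each j write (X_j, Y_j) = (R_j sin Θ_j, R_j cos Θ_j) in polar coordinates with R_j ≥ 0 and Θ_j ∈ (−π, π], and for 2 ≤ j ≤ m define U_j = (Θ_j − Θ_1) + 2π·[𝟙{Θ_j − Θ_1 ≤ −π} − 𝟙{Θ_j − Θ_1 > π}] ∈ (−π, π]. Then Θ_1 is uniformly distributed on (−π, π] and Θ_1 is independent of the random vector (U_2, …, U_m). -/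
open MeasureTheory ProbabilityTheory Real

/-- The uniform distribution on the interval `(-π, π]`. -/
noncomputable def unifNegPiPi : Measure ℝ :=
  (volume (Set.Ioc (-π) π))⁻¹ • volume.restrict (Set.Ioc (-π) π)


lemma inner_aux (w : ℂ) (hw : w ≠ 0) (A : Set ℝ) (hA : MeasurableSet A) :
    ∫⁻ α in Set.Ioc (-π) π, A.indicator (1 : ℝ → ENNReal)
      (Complex.arg (Complex.exp (α * Complex.I) * w)) = volume (A ∩ Set.Ioc (-π) π) := by
  set f : ℝ → ENNReal := fun t => A.indicator (1 : ℝ → ENNReal)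
    (Complex.arg (Complex.exp (t * Complex.I))) with hf
  have hper : ∀ (g : AddSubgroup.zmultiples (2 * π)) (x : ℝ), f (g +ᵥ x) = f x := by
    rintro ⟨g, hg⟩ x
    obtain ⟨k, rfl⟩ := AddSubgroup.mem_zmultiples_iff.1 hg
    simp only [hf]
    congr 2
    rw [Complex.exp_eq_exp_iff_exists_int]
    refine ⟨k, ?_⟩
    simp [AddSubgroup.vadd_def]
    ring
  have h1 : ∀ α : ℝ, A.indicator (1 : ℝ → ENNReal)
      (Complex.arg (Complex.exp (α * Complex.I) * w)) = f (w.arg + α) := by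
    intro α
    simp only [hf]
    congr 1
    conv_lhs => rw [← Complex.norm_mul_exp_arg_mul_I w]
    rw [mul_left_comm, ← Complex.exp_add, Complex.arg_real_mul _ (by positivity)]
    push_cast
    ring_nf
  have hfm : Measurable f := by
    apply (measurable_one.indicator hA).comp
    fun_prop
  simp_rw [h1]
  have h2 : ∫⁻ α in Set.Ioc (-π) π, f (w.arg + α)
      = ∫⁻ t in Set.Ioc (w.arg - π) (w.arg - π + 2 * π), f t := by
    have := (measurePreserving_add_left volume w.arg).setLIntegral_comp_preimage
      (s := Set.Ioc (w.arg - π) (w.arg - π + 2 * π)) measurableSet_Ioc hfm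
    rw [← this]
    congr 2
    rw [Set.preimage_const_add_Ioc]
    ring_nf
  have h3 : ∫⁻ t in Set.Ioc (w.arg - π) (w.arg - π + 2 * π), f t
      = ∫⁻ t in Set.Ioc (-π) (-π + 2 * π), f t :=
    (isAddFundamentalDomain_Ioc Real.two_pi_pos _ volume).setLIntegral_eq
      (isAddFundamentalDomain_Ioc Real.two_pi_pos _ volume) f hper
  rw [h2, h3, show -π + 2 * π = π by ring]
  have h4 : ∫⁻ t in Set.Ioc (-π) π, f t
      = ∫⁻ t in Set.Ioc (-π) π, A.indicator (1 : ℝ → ENNReal) t := by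
    apply setLIntegral_congr_fun measurableSet_Ioc
    intro t ht
    simp only [hf]
    rw [Complex.arg_exp_mul_I]
    congr 1
    rw [toIocMod_eq_self]
    convert ht using 2
    ring
  rw [h4, lintegral_indicator_one hA, Measure.restrict_apply hA]

lemma key_aux {ι : Type*} [Fintype ι] {κ : Type*} [MeasurableSpace κ]
    (ν : Measure (ι → ℂ)) [IsFiniteMeasure ν] (i : ι)
    (hrot : ∀ α : ℝ, ν.map (fun z j => Complex.exp (α * Complex.I) * z j) = ν)
    (h0 : ∀ᵐ z ∂ν, z i ≠ 0)
    (V : (ι → ℂ) → κ) (hV : Measurable V)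
    (hVrot : ∀ (α : ℝ) z, V (fun j => Complex.exp (α * Complex.I) * z j) = V z)
    (A : Set ℝ) (hA : MeasurableSet A) (B : Set κ) (hB : MeasurableSet B) :
    ν {z | (z i).arg ∈ A ∧ V z ∈ B} = unifNegPiPi A * ν {z | V z ∈ B} := by
  set s := {z : ι → ℂ | (z i).arg ∈ A ∧ V z ∈ B} with hs
  have hsB : MeasurableSet {z | V z ∈ B} := hV hB
  have hsm : MeasurableSet s := by
    apply MeasurableSet.inter _ hsB
    exact (show Measurable fun z : ι → ℂ => (z i).arg by fun_prop) hA
  have e1 : ∫⁻ _α in Set.Ioc (-π) π, ν s = ν s * volume (Set.Ioc (-π) π) := by simp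
  have hind : ∀ (α : ℝ) z, s.indicator (1 : (ι → ℂ) → ENNReal)
      (fun j => Complex.exp (α * Complex.I) * z j) =
      A.indicator (1 : ℝ → ENNReal) (Complex.arg (Complex.exp (α * Complex.I) * z i)) *
        {z | V z ∈ B}.indicator 1 z := by
    intro α z
    by_cases h1 : (Complex.exp (α * Complex.I) * z i).arg ∈ A <;> by_cases h2 : V z ∈ B <;>
      simp [hs, Set.indicator, h1, h2, hVrot]
  have hm2 : Measurable (Function.uncurry fun (α : ℝ) (z : ι → ℂ) =>
      s.indicator (1 : (ι → ℂ) → ENNReal) (fun j => Complex.exp (α * Complex.I) * z j)) := by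
    apply (measurable_one.indicator hsm).comp
    fun_prop
  have e2 : ∫⁻ _α in Set.Ioc (-π) π, ν s
      = ∫⁻ α in Set.Ioc (-π) π, ∫⁻ z, s.indicator (1 : (ι → ℂ) → ENNReal)
        (fun j => Complex.exp ((α:ℝ) * Complex.I) * z j) ∂ν := by
    congr 1 with α
    rw [← lintegral_indicator_one hsm]
    conv_lhs => rw [← hrot α]
    rw [lintegral_map (measurable_one.indicator hsm) (by fun_prop)]
  have e3 : ∫⁻ z, (∫⁻ α in Set.Ioc (-π) π, s.indicator (1 : (ι → ℂ) → ENNReal)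
        (fun j => Complex.exp ((α:ℝ) * Complex.I) * z j)) ∂ν
      = ∫⁻ z, volume (A ∩ Set.Ioc (-π) π) * {z | V z ∈ B}.indicator 1 z ∂ν := by
    apply lintegral_congr_ae
    filter_upwards [h0] with z hz
    simp_rw [hind]
    rw [lintegral_mul_const, inner_aux _ hz A hA]
    apply (measurable_one.indicator hA).comp
    fun_prop
  rw [lintegral_lintegral_swap hm2.aemeasurable, e3, e1, lintegral_const_mul _
    (measurable_one.indicator hsB), lintegral_indicator_one hsB] at e2
  have hv0 : volume (Set.Ioc (-π) π) ≠ 0 := by simp [Real.pi_pos]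
  have hvt : volume (Set.Ioc (-π) π) ≠ ⊤ := by simp
  rw [unifNegPiPi, Measure.smul_apply, Measure.restrict_apply hA, smul_eq_mul, mul_assoc, ← e2,
    mul_comm (ν s), ← mul_assoc, ENNReal.inv_mul_cancel hv0 hvt, one_mul]

lemma q_nonneg {m : ℕ} {S : Matrix (Fin m) (Fin m) ℝ} (hS : S.PosDef) (t : Fin m → ℝ) :
    0 ≤ ∑ i, ∑ j, t i * S i j * t j := by
  have := hS.posSemidef.dotProduct_mulVec_nonneg t
  simpa [dotProduct, Matrix.mulVec, Finset.mul_sum, mul_assoc] using this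

lemma law_aux {m : ℕ} (S : Matrix (Fin m) (Fin m) ℝ) (hS : S.PosDef)
    {Ω : Type*} [MeasurableSpace Ω] (P : Measure Ω) [IsProbabilityMeasure P]
    (X Y : Ω → Fin m → ℝ) (hX : Measurable X) (hY : Measurable Y)
    (hXY : IndepFun X Y P)
    (hXlaw : IsMvGaussian S (P.map X)) (hYlaw : IsMvGaussian S (P.map Y)) (a b : Fin m → ℝ) :
    P.map (fun ω => ∑ i, a i * X ω i + ∑ i, b i * Y ω i) =
      gaussianReal 0 (Real.toNNReal (∑ i, ∑ j, a i * S i j * a j + ∑ i, ∑ j, b i * S i j * b j)) := by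
  have hma : ∀ a : Fin m → ℝ, Measurable fun x : Fin m → ℝ => ∑ i, a i * x i := by
    intro a; fun_prop
  have h1 := hXlaw.2 a
  have h2 := hYlaw.2 b
  rw [Measure.map_map (hma _) hX] at h1
  rw [Measure.map_map (hma _) hY] at h2
  have := gaussianReal_add_gaussianReal_of_indepFun (hXY.comp (hma a) (hma b)) h1 h2
  rw [Real.toNNReal_add (q_nonneg hS a) (q_nonneg hS b)]
  rw [add_zero] at this
  exact this

lemma q_rot {m : ℕ} (S : Matrix (Fin m) (Fin m) ℝ) (a b : Fin m → ℝ) (c s : ℝ)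
    (h : c ^ 2 + s ^ 2 = 1) :
    ∑ i, ∑ j, (c * a i - s * b i) * S i j * (c * a j - s * b j) +
      ∑ i, ∑ j, (s * a i + c * b i) * S i j * (s * a j + c * b j) =
    ∑ i, ∑ j, a i * S i j * a j + ∑ i, ∑ j, b i * S i j * b j := by
  simp only [← Finset.sum_add_distrib]
  refine Finset.sum_congr rfl fun i _ => Finset.sum_congr rfl fun j _ => ?_
  linear_combination (a i * S i j * a j + b i * S i j * b j) * h

lemma rot_aux {m : ℕ} (S : Matrix (Fin m) (Fin m) ℝ) (hS : S.PosDef)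
    {Ω : Type*} [MeasurableSpace Ω] (P : Measure Ω) [IsProbabilityMeasure P]
    (X Y : Ω → Fin m → ℝ) (hX : Measurable X) (hY : Measurable Y)
    (hXY : IndepFun X Y P)
    (hXlaw : IsMvGaussian S (P.map X)) (hYlaw : IsMvGaussian S (P.map Y)) 
    (Z : Ω → Fin m → ℂ) (hZ : Z = fun ω j => (Y ω j : ℂ) + (X ω j : ℂ) * Complex.I) (α : ℝ) :
    (P.map Z).map (fun z j => Complex.exp (α * Complex.I) * z j) = P.map Z := by
  have hZm : Measurable Z := by rw [hZ]; fun_prop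
  have hr : Measurable (fun (z : Fin m → ℂ) j => Complex.exp (α * Complex.I) * z j) := by fun_prop
  rw [Measure.map_map hr hZm]
  have : IsProbabilityMeasure (P.map Z) := Measure.isProbabilityMeasure_map hZm.aemeasurable
  have : IsProbabilityMeasure (P.map ((fun (z : Fin m → ℂ) j =>
    Complex.exp (α * Complex.I) * z j) ∘ Z)) :=
    Measure.isProbabilityMeasure_map (hr.comp hZm).aemeasurable
  apply Measure.ext_of_charFunDual
  ext L
  have hL : ∀ z : Fin m → ℂ, L z = ∑ j, L (Pi.single j Complex.I) * (z j).im
      + ∑ j, L (Pi.single j 1) * (z j).re := by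
    intro z
    have hz : z = ∑ j, ((z j).im • (Pi.single j Complex.I : Fin m → ℂ)
        + (z j).re • (Pi.single j 1 : Fin m → ℂ)) := by
      ext k
      simp [Finset.sum_apply, Pi.single_apply, Finset.sum_add_distrib]
      rw [add_comm, Complex.re_add_im]
    conv_lhs => rw [hz]
    simp [Finset.sum_add_distrib, mul_comm]
  set a : Fin m → ℝ := fun j => L (Pi.single j Complex.I) with ha
  set b : Fin m → ℝ := fun j => L (Pi.single j 1) with hb
  have hmap : P.map (fun ω => L (Z ω)) =
      P.map (fun ω => L (fun j => Complex.exp (α * Complex.I) * Z ω j)) := by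
    have r1 : (fun ω => L (Z ω)) = fun ω => ∑ i, a i * X ω i + ∑ i, b i * Y ω i := by
      ext ω; rw [hL, hZ]; simp [a, b]
    have r2 : (fun ω => L (fun j => Complex.exp (α * Complex.I) * Z ω j)) =
        fun ω => ∑ i, (cos α * a i - sin α * b i) * X ω i
          + ∑ i, (sin α * a i + cos α * b i) * Y ω i := by
      ext ω; rw [hL, hZ]
      simp only [← Finset.sum_add_distrib]
      refine Finset.sum_congr rfl fun i _ => ?_
      simp [Complex.exp_ofReal_mul_I_re, Complex.exp_ofReal_mul_I_im, a, b]
      ring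
    rw [r1, r2, law_aux S hS P X Y hX hY hXY hXlaw hYlaw,
      law_aux S hS P X Y hX hY hXY hXlaw hYlaw, q_rot S a b _ _ (Real.cos_sq_add_sin_sq α)]
  have hLm : Measurable L := L.continuous.measurable
  have hg : StronglyMeasurable (fun t : ℝ => Complex.exp (t * Complex.I)) := by
    apply Measurable.stronglyMeasurable; fun_prop
  rw [charFunDual_eq_charFun_map_one, charFunDual_eq_charFun_map_one,
    Measure.map_map hLm (hr.comp hZm), Measure.map_map hLm hZm]
  congr 1
  exact hmap.symm

lemma angle_aux {r s t u : ℝ} (hr : 0 < r) (hs : 0 < s) (ht : t ∈ Set.Ioc (-π) π)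
    (hu : u ∈ Set.Ioc (-π) π) :
    (t - u) + 2 * π * ((if t - u ≤ -π then (1 : ℝ) else 0) - (if π < t - u then (1 : ℝ) else 0))
    = Complex.arg (((r * cos t : ℝ) + (r * sin t : ℝ) * Complex.I) *
      (starRingEnd ℂ) ((s * cos u : ℝ) + (s * sin u : ℝ) * Complex.I)) := by
  set w := (t - u) + 2 * π * ((if t - u ≤ -π then (1 : ℝ) else 0) -
    (if π < t - u then (1 : ℝ) else 0)) with hw
  have hpi := Real.pi_pos
  obtain ⟨ht1, ht2⟩ := ht
  obtain ⟨hu1, hu2⟩ := hu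
  have hwm : w ∈ Set.Ioc (-π) π := by
    rw [hw]; split_ifs <;> constructor <;> linarith
  have hcos : cos w = cos (t - u) ∧ sin w = sin (t - u) := by
    rw [hw]; split_ifs
    · linarith
    · simp
    · rw [show t - u + 2 * π * (0 - 1) = t - u - 2 * π by ring]; simp
    · simp
  rw [← Complex.arg_mul_cos_add_sin_mul_I (mul_pos hr hs) hwm]
  congr 1
  rw [← Complex.ofReal_cos, ← Complex.ofReal_sin, hcos.1, hcos.2, Real.cos_sub, Real.sin_sub]
  apply Complex.ext <;> simp <;> ring

theorem statement8 {m : ℕ} (hm : 2 ≤ m) (S : Matrix (Fin m) (Fin m) ℝ) (hS : S.PosDef)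
    {Ω : Type*} [MeasurableSpace Ω] (P : Measure Ω) [IsProbabilityMeasure P]
    (X Y : Ω → Fin m → ℝ) (hX : Measurable X) (hY : Measurable Y)
    (hXY : IndepFun X Y P)
    (hXlaw : IsMvGaussian S (P.map X)) (hYlaw : IsMvGaussian S (P.map Y))
    -- polar coordinates: `(X_j, Y_j) = (R_j sin Θ_j, R_j cos Θ_j)` with
    -- `R_j ≥ 0` and `Θ_j ∈ (-π, π]`
    (R Θ : Fin m → Ω → ℝ) (hΘmeas : ∀ j, Measurable (Θ j))
    (hR0 : ∀ j ω, 0 ≤ R j ω) (hΘmem : ∀ j ω, Θ j ω ∈ Set.Ioc (-π) π)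
    (hpolar : ∀ j ω, X ω j = R j ω * Real.sin (Θ j ω) ∧ Y ω j = R j ω * Real.cos (Θ j ω)) :
    -- `Θ₁` is uniform on `(-π, π]` and is independent of `(U_2, …, U_m)`, where
    -- `U_j = (Θ_j - Θ₁) + 2π·[𝟙{Θ_j - Θ₁ ≤ -π} - 𝟙{Θ_j - Θ₁ > π}]`
    P.map (Θ ⟨0, by omega⟩) = unifNegPiPi ∧
    IndepFun (Θ ⟨0, by omega⟩)
      (fun ω (j : {j : Fin m // j ≠ ⟨0, by omega⟩}) =>
        (Θ j.1 ω - Θ ⟨0, by omega⟩ ω) +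
          2 * π * ((if Θ j.1 ω - Θ ⟨0, by omega⟩ ω ≤ -π then (1 : ℝ) else 0) -
            (if π < Θ j.1 ω - Θ ⟨0, by omega⟩ ω then (1 : ℝ) else 0))) P := by
  set i0 : Fin m := ⟨0, by omega⟩ with hi0
  set U : Ω → {j : Fin m // j ≠ i0} → ℝ := fun ω j => (Θ j.1 ω - Θ i0 ω) +
          2 * π * ((if Θ j.1 ω - Θ i0 ω ≤ -π then (1 : ℝ) else 0) -
            (if π < Θ j.1 ω - Θ i0 ω then (1 : ℝ) else 0)) with hU
  obtain ⟨Z, hZ⟩ : ∃ Z : Ω → Fin m → ℂ,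
    Z = fun ω j => (Y ω j : ℂ) + (X ω j : ℂ) * Complex.I := ⟨_, rfl⟩
  have hZm : Measurable Z := by rw [hZ]; fun_prop
  have hXne : ∀ j, ∀ᵐ ω ∂P, X ω j ≠ 0 := by
    intro j
    have h := hXlaw.2 (Pi.single j 1)
    have hs : ∑ i, ∑ k, (Pi.single j 1 : Fin m → ℝ) i * S i k * (Pi.single j 1 : Fin m → ℝ) k
        = S j j := by simp [Pi.single_apply]
    have hf : (fun x : Fin m → ℝ => ∑ i, (Pi.single j 1 : Fin m → ℝ) i * x i)
        = fun x => x j := by ext x; simp [Pi.single_apply]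
    rw [hs, hf, Measure.map_map (by fun_prop) hX] at h
    have hv : Real.toNNReal (S j j) ≠ 0 := by
      have := hS.diag_pos (i := j)
      simpa using this
    have := nullSingletonClass_gaussianReal (μ := 0) hv
    have h0 : (P.map ((fun x : Fin m → ℝ => x j) ∘ X)) {0} = 0 := by rw [h]; exact measure_singleton 0
    rw [Measure.map_apply (by fun_prop) (measurableSet_singleton 0)] at h0
    exact measure_eq_zero_iff_ae_notMem.1 h0
  have hRpos : ∀ᵐ ω ∂P, ∀ j, 0 < R j ω := by
    rw [ae_all_iff]
    intro j
    filter_upwards [hXne j] with ω hω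
    refine lt_of_le_of_ne (hR0 j ω) fun h => hω ?_
    rw [(hpolar j ω).1, ← h, zero_mul]
  have hZp : ∀ ω j, Z ω j = (R j ω * cos (Θ j ω) : ℝ) + (R j ω * sin (Θ j ω) : ℝ) * Complex.I := by
    intro ω j
    rw [← (hpolar j ω).1, ← (hpolar j ω).2, hZ]
  let V : (Fin m → ℂ) → {j : Fin m // j ≠ i0} → ℝ :=
    fun z j => Complex.arg (z j.1 * (starRingEnd ℂ) (z i0))
  have hV : Measurable V := by
    apply measurable_pi_lambda
    intro j
    have hc : Measurable (starRingEnd ℂ) := Complex.continuous_conj.measurable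
    have : Measurable fun z : Fin m → ℂ => z j.1 * (starRingEnd ℂ) (z i0) :=
      (measurable_pi_apply _).mul (hc.comp (measurable_pi_apply _))
    exact Complex.measurable_arg.comp this
  have hVrot : ∀ (α : ℝ) z, V (fun j => Complex.exp (α * Complex.I) * z j) = V z := by
    intro α z
    ext j
    simp only [V]
    congr 1
    have : Complex.exp (α * Complex.I) * (starRingEnd ℂ) (Complex.exp (α * Complex.I)) = 1 := by
      rw [Complex.mul_conj, Complex.normSq_eq_norm_sq, Complex.norm_exp_ofReal_mul_I]; simp
    rw [map_mul]
    linear_combination (z j.1 * (starRingEnd ℂ) (z i0)) * this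
  have hΘe : ∀ᵐ ω ∂P, (Z ω i0).arg = Θ i0 ω ∧ V (Z ω) = U ω := by
    filter_upwards [hRpos] with ω hω
    constructor
    · rw [hZp]
      refine Eq.trans ?_ (Complex.arg_mul_cos_add_sin_mul_I (hω i0) (hΘmem i0 ω))
      congr 1
      push_cast
      ring
    · ext j
      simp only [V, U]
      rw [angle_aux (hω j.1) (hω i0) (hΘmem j.1 ω) (hΘmem i0 ω), hZp, hZp]
  have : IsProbabilityMeasure (P.map Z) := Measure.isProbabilityMeasure_map hZm.aemeasurable
  have hne : ∀ᵐ z ∂(P.map Z), z i0 ≠ 0 := by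
    rw [ae_map_iff hZm.aemeasurable]
    · filter_upwards [hXne i0] with ω hω h
      apply hω
      have := congrArg Complex.im h
      simpa [hZ] using this
    · exact ((show Measurable fun z : Fin m → ℂ => z i0 by fun_prop)
        (measurableSet_singleton (0 : ℂ))).compl
  have key : ∀ A : Set ℝ, MeasurableSet A → ∀ B, MeasurableSet B →
      P (Θ i0 ⁻¹' A ∩ U ⁻¹' B) = unifNegPiPi A * P (U ⁻¹' B) := by
    intro A hA B hB
    have h := key_aux (P.map Z) i0 (rot_aux S hS P X Y hX hY hXY hXlaw hYlaw Z hZ) hne V hV hVrot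
      A hA B hB
    have hB' : MeasurableSet {z | V z ∈ B} := hV hB
    have hAB : MeasurableSet {z : Fin m → ℂ | (z i0).arg ∈ A ∧ V z ∈ B} :=
      ((show Measurable fun z : Fin m → ℂ => (z i0).arg by fun_prop) hA).inter (hV hB)
    rw [Measure.map_apply hZm hB', Measure.map_apply hZm hAB] at h
    have g1 : P (Θ i0 ⁻¹' A ∩ U ⁻¹' B) = P (Z ⁻¹' {z | (z i0).arg ∈ A ∧ V z ∈ B}) := by
      apply measure_congr
      filter_upwards [hΘe] with ω hω
      apply propext
      change (Θ i0 ω ∈ A ∧ U ω ∈ B) ↔ ((Z ω i0).arg ∈ A ∧ V (Z ω) ∈ B)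
      rw [hω.1, hω.2]
    have g2 : P (U ⁻¹' B) = P (Z ⁻¹' {z | V z ∈ B}) := by
      apply measure_congr
      filter_upwards [hΘe] with ω hω
      apply propext
      change (U ω ∈ B) ↔ (V (Z ω) ∈ B)
      rw [hω.2]
    rw [g1, g2]
    exact h
  have hunif : ∀ A : Set ℝ, MeasurableSet A → P (Θ i0 ⁻¹' A) = unifNegPiPi A := by
    intro A hA
    simpa using key A hA Set.univ MeasurableSet.univ
  refine ⟨?_, ?_⟩
  · ext A hA
    rw [Measure.map_apply (hΘmeas i0) hA, hunif A hA]
  · rw [indepFun_iff_measure_inter_preimage_eq_mul]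
    intro A B hA hB
    rw [key A hA B hB, hunif A hA]
end
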